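/- arXiv:1405.0694 — 14 statements merged into one kernel-verified Lean document; each statement's English description precedes it below -/
import Mathlib

section
/- Let A, B, C be real numbers with A·B·C > 0 and suppose 1/|A| + 1/|B| + 1/|C| ≥ 2·max{1/|A|, 1/|B|, 1/|C|}. Then the minimum over (θ₁, θ₂) ∈ ℝ² of f(θ₁, θ₂) = A·cos(θ₁ − θ₂) + B·cos(θ₂) + C·cos(θ₁) equals −(A·B·C/2)·(1/A² + 1/B² + 1/C²); that is, f(θ₁, θ₂) ≥ −(A·B·C/2)·(1/A² + 1/B² + 1/C²) for all (θ₁, θ₂) and this value is attained. -/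
open Real

/-- Every point of the unit circle has an angle. -/
theorem exists_cos_sin_eq {x y : ℝ} (h : x ^ 2 + y ^ 2 = 1) :
    ∃ θ : ℝ, cos θ = x ∧ sin θ = y := by
  have hn : ‖(⟨x, y⟩ : ℂ)‖ = 1 := by
    rw [← sq_eq_sq₀ (norm_nonneg _) zero_le_one, ← Complex.normSq_eq_norm_sq, Complex.normSq_mk]
    linarith
  have h0 : (⟨x, y⟩ : ℂ) ≠ 0 := norm_ne_zero_iff.mp (by rw [hn]; exact one_ne_zero)
  exact ⟨Complex.arg ⟨x, y⟩, by rw [Complex.cos_arg h0, hn, div_one],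
    by rw [Complex.sin_arg, hn, div_one]⟩

/-- Up to an additive constant, the trigonometric polynomial is the squared norm of
`a + b * exp (i θ₁) + c * exp (i θ₂)`. -/
theorem trig_eq_sq_add_sq {a b c : ℝ} (ha : a ≠ 0) (hb : b ≠ 0) (hc : c ≠ 0) (θ₁ θ₂ : ℝ) :
    a⁻¹ * cos (θ₁ - θ₂) + b⁻¹ * cos θ₂ + c⁻¹ * cos θ₁ =
      (a⁻¹ * b⁻¹ * c⁻¹ / 2) * ((a + b * cos θ₁ + c * cos θ₂) ^ 2
        + (b * sin θ₁ + c * sin θ₂) ^ 2 - (a ^ 2 + b ^ 2 + c ^ 2)) := by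
  rw [cos_sub]
  field_simp
  linear_combination (-b ^ 2) * sin_sq_add_cos_sq θ₁ - c ^ 2 * sin_sq_add_cos_sq θ₂

/-- Three lengths satisfying the triangle inequalities are the sides of a closed triangle;
the signs of `a`, `b`, `c` are absorbed in the directions. -/
theorem exists_closed_triangle {a b c : ℝ} (ha : a ≠ 0) (hb : b ≠ 0) (hc : c ≠ 0)
    (h₁ : |a| ≤ |b| + |c|) (h₂ : |b| ≤ |a| + |c|) (h₃ : |c| ≤ |a| + |b|) :
    ∃ θ₁ θ₂ : ℝ, a + b * cos θ₁ + c * cos θ₂ = 0 ∧ b * sin θ₁ + c * sin θ₂ = 0 := by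
  have hheron : (c ^ 2 - a ^ 2 - b ^ 2) ^ 2 ≤ (2 * a * b) ^ 2 := by
    have hprod : 0 ≤ (|a| + |b| + |c|) * (|b| + |c| - |a|) * (|a| + |c| - |b|)
        * (|a| + |b| - |c|) :=
      mul_nonneg (mul_nonneg (mul_nonneg (by positivity) (by linarith)) (by linarith))
        (by linarith)
    rw [mul_pow, mul_pow, ← sq_abs a, ← sq_abs b, ← sq_abs c]
    linarith
  set p := (c ^ 2 - a ^ 2 - b ^ 2) / (2 * a * b) with hp
  have hp1 : p ^ 2 ≤ 1 := by
    rw [hp, div_pow]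
    exact div_le_one_of_le₀ hheron (sq_nonneg _)
  have hs : √(1 - p ^ 2) ^ 2 = 1 - p ^ 2 := sq_sqrt (by linarith)
  have hpm : p * (2 * a * b) = c ^ 2 - a ^ 2 - b ^ 2 := div_mul_cancel₀ _ (by positivity)
  obtain ⟨θ₁, hc₁, hs₁⟩ := exists_cos_sin_eq (x := p) (y := √(1 - p ^ 2)) (by linarith)
  obtain ⟨θ₂, hc₂, hs₂⟩ := exists_cos_sin_eq (x := -(a + b * p) / c)
      (y := -(b * √(1 - p ^ 2)) / c) (by
    rw [div_pow, div_pow, ← add_div, div_eq_one_iff_eq (pow_ne_zero 2 hc)]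
    linear_combination b ^ 2 * hs + hpm)
  refine ⟨θ₁, θ₂, ?_, ?_⟩
  · rw [hc₁, hc₂, mul_div_cancel₀ _ hc]
    ring
  · rw [hs₁, hs₂, mul_div_cancel₀ _ hc]
    ring

/-- Minimum of `f(θ₁,θ₂) = A·cos(θ₁−θ₂) + B·cos θ₂ + C·cos θ₁` when `A·B·C > 0` and
`1/|A| + 1/|B| + 1/|C| ≥ 2·max{1/|A|, 1/|B|, 1/|C|}`. -/
theorem trig_min_case1 (A B C : ℝ) (hABC : A * B * C > 0)
    (h : 1 / |A| + 1 / |B| + 1 / |C| ≥ 2 * max (max (1 / |A|) (1 / |B|)) (1 / |C|)) :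
    IsLeast {y : ℝ | ∃ θ₁ θ₂ : ℝ,
        y = A * Real.cos (θ₁ - θ₂) + B * Real.cos θ₂ + C * Real.cos θ₁}
      (-(A * B * C / 2) * (1 / A ^ 2 + 1 / B ^ 2 + 1 / C ^ 2)) := by
  have hA : A ≠ 0 := by rintro rfl; simp at hABC
  have hB : B ≠ 0 := by rintro rfl; simp at hABC
  have hC : C ≠ 0 := by rintro rfl; simp at hABC
  have key := trig_eq_sq_add_sq (inv_ne_zero hA) (inv_ne_zero hB) (inv_ne_zero hC)
  simp only [inv_inv] at key
  simp only [one_div, ← inv_pow, ← abs_inv] at h ⊢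
  constructor
  · have hmA := (le_max_left |A⁻¹| |B⁻¹|).trans (le_max_left _ |C⁻¹|)
    have hmB := (le_max_right |A⁻¹| |B⁻¹|).trans (le_max_left _ |C⁻¹|)
    have hmC := le_max_right (max |A⁻¹| |B⁻¹|) |C⁻¹|
    obtain ⟨θ₁, θ₂, hx, hy⟩ := exists_closed_triangle (inv_ne_zero hA) (inv_ne_zero hB)
      (inv_ne_zero hC) (by linarith) (by linarith) (by linarith)
    refine ⟨θ₁, θ₂, ?_⟩
    rw [key, hx, hy]
    ring
  · rintro _ ⟨θ₁, θ₂, rfl⟩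
    rw [key, neg_mul, ← mul_neg]
    refine mul_le_mul_of_nonneg_left ?_ (by linarith)
    linarith [sq_nonneg (A⁻¹ + B⁻¹ * cos θ₁ + C⁻¹ * cos θ₂),
      sq_nonneg (B⁻¹ * sin θ₁ + C⁻¹ * sin θ₂)]
end

section
/- Let A, B, C be real numbers with A·B·C > 0 and suppose 1/|A| + 1/|B| + 1/|C| ≤ 2·max{1/|A|, 1/|B|, 1/|C|}. Then the minimum over (θ₁, θ₂) ∈ ℝ² of f(θ₁, θ₂) = A·cos(θ₁ − θ₂) + B·cos(θ₂) + C·cos(θ₁) equals −(|A| + |B| + |C|) + 2·min{|A|, |B|, |C|}; that is, f(θ₁, θ₂) ≥ −(|A| + |B| + |C|) + 2·min{|A|, |B|, |C|} for all (θ₁, θ₂) and this value is attained. -/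
open Real

theorem mul_add_sq_le_of_mul_add_le {a b c : ℝ} (hb : 0 < b) (hc : 0 < c)
    (h : a * (b + c) ≤ b * c) (s t : ℝ) : a * (s + t) ^ 2 ≤ b * s ^ 2 + c * t ^ 2 := by
  have hbc : 0 < b + c := add_pos hb hc
  refine le_of_mul_le_mul_left ?_ hbc
  nlinarith [mul_le_mul_of_nonneg_right h (sq_nonneg (s + t)), sq_nonneg (b * s - c * t)]

theorem mul_one_sub_cos_add_le {a b c : ℝ} (ha : 0 < a) (hb : 0 < b) (hc : 0 < c)
    (h : a * (b + c) ≤ b * c) (u v : ℝ) :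
    a * (1 - cos (u + v)) ≤ b * (1 - cos u) + c * (1 - cos v) := by
  have half (x : ℝ) : 1 - cos x = 2 * sin (x / 2) ^ 2 := by
    have := sin_sq_eq_half_sub (x / 2)
    rw [show 2 * (x / 2) = x by ring] at this
    linarith
  have hsin : |sin ((u + v) / 2)| ≤ |sin (u / 2)| + |sin (v / 2)| := by
    rw [add_div, sin_add]
    refine (abs_add_le _ _).trans ?_
    rw [abs_mul, abs_mul]
    exact add_le_add (mul_le_of_le_one_right (abs_nonneg _) (abs_cos_le_one _))
      (mul_le_of_le_one_left (abs_nonneg _) (abs_cos_le_one _))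
  have hsq : sin ((u + v) / 2) ^ 2 ≤ (|sin (u / 2)| + |sin (v / 2)|) ^ 2 := by
    rw [← sq_abs]
    gcongr
  have hcs := mul_add_sq_le_of_mul_add_le hb hc h |sin (u / 2)| |sin (v / 2)|
  rw [sq_abs, sq_abs] at hcs
  rw [half, half, half]
  nlinarith [mul_le_mul_of_nonneg_left hsq ha.le]

theorem exists_shift_mul_cos {A B C : ℝ} (hABC : 0 < A * B * C) :
    ∃ p q : ℝ, (∀ u, B * cos (u + p) = -|B| * cos u) ∧ (∀ v, C * cos (v + q) = -|C| * cos v) ∧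
      ∀ w, A * cos (w + (p + q)) = |A| * cos w := by
  have hA : A ≠ 0 := by rintro rfl; simp at hABC
  have hB : B ≠ 0 := by rintro rfl; simp at hABC
  have hC : C ≠ 0 := by rintro rfl; simp at hABC
  rcases lt_or_gt_of_ne hB with hB | hB <;> rcases lt_or_gt_of_ne hC with hC | hC
  · have hA : 0 < A := by
      rw [mul_assoc] at hABC
      exact pos_of_mul_pos_left hABC (mul_pos_of_neg_of_neg hB hC).le
    exact ⟨0, 0, by simp [abs_of_neg hB], by simp [abs_of_neg hC], by simp [abs_of_pos hA]⟩
  · have hA : A < 0 := by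
      rw [mul_assoc] at hABC
      exact neg_of_mul_pos_left hABC (mul_neg_of_neg_of_pos hB hC).le
    exact ⟨0, π, by simp [abs_of_neg hB], by simp [abs_of_pos hC], by simp [abs_of_neg hA]⟩
  · have hA : A < 0 := by
      rw [mul_assoc] at hABC
      exact neg_of_mul_pos_left hABC (mul_neg_of_pos_of_neg hB hC).le
    exact ⟨π, 0, by simp [abs_of_pos hB], by simp [abs_of_neg hC], by simp [abs_of_neg hA]⟩
  · have hA : 0 < A := by
      rw [mul_assoc] at hABC
      exact pos_of_mul_pos_left hABC (mul_pos hB hC).le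
    exact ⟨π, π, by simp [abs_of_pos hB], by simp [abs_of_pos hC],
      by simp [abs_of_pos hA, ← two_mul]⟩

theorem cos_add_combination_min {A B C : ℝ} (hABC : 0 < A * B * C)
    (h : |A| * (|B| + |C|) ≤ |B| * |C|) :
    (∃ y z : ℝ, A * cos (y + z) + B * cos y + C * cos z = |A| - |B| - |C|) ∧
      ∀ y z : ℝ, |A| - |B| - |C| ≤ A * cos (y + z) + B * cos y + C * cos z := by
  have hA : A ≠ 0 := by rintro rfl; simp at hABC
  have hB : B ≠ 0 := by rintro rfl; simp at hABC
  have hC : C ≠ 0 := by rintro rfl; simp at hABC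
  obtain ⟨p, q, hp, hq, hpq⟩ := exists_shift_mul_cos hABC
  constructor
  · refine ⟨p, q, ?_⟩
    have h₁ := hp 0
    have h₂ := hq 0
    have h₃ := hpq 0
    simp only [zero_add, cos_zero] at h₁ h₂ h₃
    linarith
  · intro y z
    have h₁ := hp (y - p)
    have h₂ := hq (z - q)
    have h₃ := hpq ((y - p) + (z - q))
    rw [sub_add_cancel] at h₁ h₂
    rw [show y - p + (z - q) + (p + q) = y + z by ring] at h₃
    have := mul_one_sub_cos_add_le (abs_pos.2 hA) (abs_pos.2 hB) (abs_pos.2 hC) h (y - p) (z - q)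
    linarith

theorem mul_add_le_of_inv_add_inv_le {a b c : ℝ} (ha : 0 < a) (hb : 0 < b) (hc : 0 < c)
    (h : 1 / b + 1 / c ≤ 1 / a) : a * (b + c) ≤ b * c := by
  rw [div_add_div _ _ hb.ne' hc.ne', div_le_div_iff₀ (mul_pos hb hc) ha] at h
  linarith

theorem le_of_mul_add_le_mul {a b c : ℝ} (ha : 0 < a) (hb : 0 < b) (hc : 0 < c)
    (h : a * (b + c) ≤ b * c) : a ≤ b ∧ a ≤ c :=
  ⟨le_of_mul_le_mul_right (by nlinarith [mul_pos ha hb]) hc,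
    le_of_mul_le_mul_left (by nlinarith [mul_pos ha hc]) hb⟩

/-- Minimum of `f(θ₁,θ₂) = A·cos(θ₁−θ₂) + B·cos θ₂ + C·cos θ₁` when `A·B·C > 0` and
`1/|A| + 1/|B| + 1/|C| ≤ 2·max{1/|A|, 1/|B|, 1/|C|}`. -/
theorem trig_min_case2 (A B C : ℝ) (hABC : A * B * C > 0)
    (h : 1 / |A| + 1 / |B| + 1 / |C| ≤ 2 * max (max (1 / |A|) (1 / |B|)) (1 / |C|)) :
    IsLeast {y : ℝ | ∃ θ₁ θ₂ : ℝ,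
        y = A * Real.cos (θ₁ - θ₂) + B * Real.cos θ₂ + C * Real.cos θ₁}
      (-(|A| + |B| + |C|) + 2 * min (min |A| |B|) |C|) := by
  have hA : 0 < |A| := abs_pos.2 (by rintro rfl; simp at hABC)
  have hB : 0 < |B| := abs_pos.2 (by rintro rfl; simp at hABC)
  have hC : 0 < |C| := abs_pos.2 (by rintro rfl; simp at hABC)
  have hcases : 1 / |B| + 1 / |C| ≤ 1 / |A| ∨ 1 / |A| + 1 / |C| ≤ 1 / |B| ∨
      1 / |A| + 1 / |B| ≤ 1 / |C| := by
    rcases max_choice (max (1 / |A|) (1 / |B|)) (1 / |C|) with h₁ | h₁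
    · rcases max_choice (1 / |A|) (1 / |B|) with h₂ | h₂
      · rw [h₁, h₂] at h
        exact Or.inl (by linarith)
      · rw [h₁, h₂] at h
        exact Or.inr (Or.inl (by linarith))
    · rw [h₁] at h
      exact Or.inr (Or.inr (by linarith))
  rcases hcases with h' | h' | h'
  · have hm := mul_add_le_of_inv_add_inv_le hA hB hC h'
    obtain ⟨hAB, hAC⟩ := le_of_mul_add_le_mul hA hB hC hm
    obtain ⟨⟨y, z, hyz⟩, hlb⟩ := cos_add_combination_min hABC hm
    rw [min_eq_left hAB, min_eq_left hAC]
    constructor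
    · refine ⟨z, -y, ?_⟩
      rw [sub_neg_eq_add, add_comm z y, cos_neg]
      linarith
    · rintro _ ⟨θ₁, θ₂, rfl⟩
      have := hlb (-θ₂) θ₁
      rw [neg_add_eq_sub, cos_neg] at this
      linarith
  · have hm := mul_add_le_of_inv_add_inv_le hB hA hC h'
    obtain ⟨hBA, hBC⟩ := le_of_mul_add_le_mul hB hA hC hm
    obtain ⟨⟨y, z, hyz⟩, hlb⟩ := cos_add_combination_min (by linarith : 0 < B * A * C) hm
    rw [min_eq_right hBA, min_eq_left hBC]
    constructor
    · refine ⟨z, y + z, ?_⟩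
      rw [show z - (y + z) = -y by ring, cos_neg]
      linarith
    · rintro _ ⟨θ₁, θ₂, rfl⟩
      have := hlb (θ₂ - θ₁) θ₁
      rw [sub_add_cancel, ← cos_neg (θ₂ - θ₁), neg_sub] at this
      linarith
  · have hm := mul_add_le_of_inv_add_inv_le hC hA hB h'
    obtain ⟨hCA, hCB⟩ := le_of_mul_add_le_mul hC hA hB hm
    obtain ⟨⟨y, z, hyz⟩, hlb⟩ := cos_add_combination_min (by linarith : 0 < C * A * B) hm
    rw [min_eq_right (le_min hCA hCB)]
    constructor
    · refine ⟨y + z, z, ?_⟩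
      rw [add_sub_cancel_right]
      linarith
    · rintro _ ⟨θ₁, θ₂, rfl⟩
      have := hlb (θ₁ - θ₂) θ₂
      rw [sub_add_cancel] at this
      linarith
end

section
/- Let a, b, c > 0, k > 0 with sin(a·k) ≠ 0, sin(b·k) ≠ 0, sin(c·k) ≠ 0, and let α ∈ ℝ. If the gap condition GC1 holds, i.e. |cot(a·k) + cot(b·k) + cot(c·k) + α/k| > 1/|sin(a·k)| + 1/|sin(b·k)| + 1/|sin(c·k)|, then either sgn(cot(a·k)) = sgn(cot(b·k)) = sgn(cot(c·k)) = sgn(α), or k < |α|. -/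
open Real

theorem Real.one_le_one_div_abs_sin {x : ℝ} (hx : Real.sin x ≠ 0) : 1 ≤ 1 / |Real.sin x| := by
  rw [le_div_iff₀ (abs_pos.mpr hx), one_mul]
  exact Real.abs_sin_le_one x

theorem Real.abs_cot_le_one_div_abs_sin (x : ℝ) : |Real.cot x| ≤ 1 / |Real.sin x| := by
  rw [Real.cot_eq_cos_div_sin, abs_div]
  exact div_le_div_of_nonneg_right (Real.abs_cos_le_one x) (abs_nonneg _)

theorem pos_of_sum_lt_sum_add {x y z t p q r : ℝ} (hp : 1 ≤ p) (hq : 1 ≤ q) (hr : 1 ≤ r)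
    (hxp : |x| ≤ p) (hyq : |y| ≤ q) (hzr : |z| ≤ r) (ht : |t| ≤ 1)
    (h : p + q + r < x + y + z + t) : 0 < x ∧ 0 < y ∧ 0 < z ∧ 0 < t := by
  rw [abs_le] at hxp hyq hzr ht
  refine ⟨?_, ?_, ?_, ?_⟩ <;> linarith

/-- If the gap condition GC1 holds at `k > 0`, then either all of `cot(a·k)`, `cot(b·k)`,
`cot(c·k)` have the same sign as `α`, or `k < |α|`. -/
theorem GC1_sign_condition (a b c k α : ℝ) (ha : 0 < a) (hb : 0 < b) (hc : 0 < c)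
    (hk : 0 < k)
    (hsa : Real.sin (a * k) ≠ 0) (hsb : Real.sin (b * k) ≠ 0) (hsc : Real.sin (c * k) ≠ 0)
    (hGC1 : |Real.cot (a * k) + Real.cot (b * k) + Real.cot (c * k) + α / k|
      > 1 / |Real.sin (a * k)| + 1 / |Real.sin (b * k)| + 1 / |Real.sin (c * k)|) :
    (Real.sign (Real.cot (a * k)) = Real.sign (Real.cot (b * k)) ∧
     Real.sign (Real.cot (b * k)) = Real.sign (Real.cot (c * k)) ∧
     Real.sign (Real.cot (c * k)) = Real.sign α) ∨ k < |α| := by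
  refine or_iff_not_imp_right.mpr fun hα => ?_
  have ht : |α / k| ≤ 1 := by
    rw [abs_div, abs_of_pos hk, div_le_one hk]
    exact not_lt.mp hα
  have hpa := Real.one_le_one_div_abs_sin hsa
  have hpb := Real.one_le_one_div_abs_sin hsb
  have hpc := Real.one_le_one_div_abs_sin hsc
  have hxa := Real.abs_cot_le_one_div_abs_sin (a * k)
  have hxb := Real.abs_cot_le_one_div_abs_sin (b * k)
  have hxc := Real.abs_cot_le_one_div_abs_sin (c * k)
  rcases lt_abs.mp hGC1 with h | h
  · obtain ⟨h1, h2, h3, h4⟩ := pos_of_sum_lt_sum_add hpa hpb hpc hxa hxb hxc ht h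
    have hα' : 0 < α := (div_pos_iff_of_pos_right hk).mp h4
    simp [Real.sign_of_pos, h1, h2, h3, hα']
  · rw [← abs_neg] at hxa hxb hxc ht
    obtain ⟨h1, h2, h3, h4⟩ :=
      pos_of_sum_lt_sum_add hpa hpb hpc hxa hxb hxc ht (by linarith)
    rw [neg_pos] at h1 h2 h3 h4
    have hα' : α < 0 := by
      by_contra! hn
      exact absurd h4 (not_lt.mpr (div_nonneg hn hk.le))
    simp [Real.sign_of_neg, h1, h2, h3, hα']
end

section
/- Let a, b, c > 0, α ∈ ℝ, and let k > 0 satisfy k ≥ |α| and sin(a·k) ≠ 0, sin(b·k) ≠ 0, sin(c·k) ≠ 0. Then the gap condition GC1, i.e. |cot(a·k) + cot(b·k) + cot(c·k) + α/k| > 1/|sin(a·k)| + 1/|sin(b·k)| + 1/|sin(c·k)|, holds if and only if sgn(cot(a·k)) = sgn(cot(b·k)) = sgn(cot(c·k)) = sgn(α) and |tan({a·k/π}·π/2)| + |tan({b·k/π}·π/2)| + |tan({c·k/π}·π/2)| < |α|/k. -/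
open Real

/-- Half-angle identities for `x` reduced modulo `π` to `[-π/2, π/2]`. -/
theorem abs_tan_half_reduced {x : ℝ} (hx : Real.sin x ≠ 0) :
    0 < |Real.tan ((x / π - round (x / π)) * (π / 2))| ∧
    2 * |Real.tan ((x / π - round (x / π)) * (π / 2))| * |Real.cot x|
      = 1 - |Real.tan ((x / π - round (x / π)) * (π / 2))| ^ 2 ∧
    1 / |Real.sin x| = |Real.cot x| + |Real.tan ((x / π - round (x / π)) * (π / 2))| := by
  set n := round (x / π)
  set h := (x / π - n) * (π / 2) with hh
  have hπ := Real.pi_pos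
  have hxh : x = 2 * h + n * π := by
    rw [hh]
    field_simp
    ring
  have hround : |x / π - n| ≤ 1 / 2 := abs_sub_round (x / π)
  obtain ⟨h₁, h₂⟩ := abs_le.mp hround
  have hlow : -(π / 4) ≤ h := by rw [hh]; nlinarith
  have hupp : h ≤ π / 4 := by rw [hh]; nlinarith
  have hcos : 0 < Real.cos h := Real.cos_pos_of_mem_Ioo ⟨by linarith, by linarith⟩
  have hcos2 : 0 ≤ Real.cos (2 * h) :=
    Real.cos_nonneg_of_mem_Icc ⟨by linarith, by linarith⟩
  have hsq := Real.sin_sq_add_cos_sq h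
  have habs_sin : |Real.sin x| = 2 * |Real.sin h| * Real.cos h := by
    rw [hxh, Real.sin_add_int_mul_pi, abs_mul, abs_zpow, abs_neg, abs_one, one_zpow, one_mul,
      Real.sin_two_mul, abs_mul, abs_mul, abs_two, abs_of_pos hcos]
  have habs_cos : |Real.cos x| = Real.cos h ^ 2 - |Real.sin h| ^ 2 := by
    rw [hxh, Real.cos_add_int_mul_pi, abs_mul, abs_zpow, abs_neg, abs_one, one_zpow, one_mul,
      abs_of_nonneg hcos2, Real.cos_two_mul, sq_abs]
    linarith
  have hsin : 0 < |Real.sin h| := by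
    have := abs_pos.mpr hx
    rw [habs_sin] at this
    by_contra hneg
    nlinarith [abs_nonneg (Real.sin h)]
  rw [Real.cot_eq_cos_div_sin, Real.tan_eq_sin_div_cos, abs_div, abs_div, habs_sin, habs_cos,
    abs_of_pos hcos]
  rw [← sq_abs] at hsq
  refine ⟨by positivity, ?_, ?_⟩
  · field_simp
  · field_simp
    linarith

theorem mul_pos_of_lt_abs_add {x y β s Y S : ℝ} (hs : 0 < s) (hxs : 2 * s * |x| = 1 - s ^ 2)
    (hβ : |β| ≤ 1) (hy : |y| ≤ Y) (hS : 0 < S) (h : |x| + Y + s + S < |x + y + β|) :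
    0 < x * β := by
  obtain ⟨hβ₁, hβ₂⟩ := abs_le.mp hβ
  obtain ⟨hy₁, hy₂⟩ := abs_le.mp hy
  have hlt : |x| + s + S < |x + β| := by
    have := abs_add_le (x + β) y
    rw [show x + β + y = x + y + β by ring] at this
    linarith
  by_contra! hneg
  rcases lt_abs.mp hlt with h' | h' <;> rcases abs_cases x with ⟨e, hx⟩ | ⟨e, hx⟩ <;>
    rw [e] at h' hxs <;> nlinarith

theorem sign_eq_sign_of_mul_pos {x y : ℝ} (h : 0 < x * y) : Real.sign x = Real.sign y := by
  rcases mul_pos_iff.mp h with ⟨hx, hy⟩ | ⟨hx, hy⟩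
  · rw [Real.sign_of_pos hx, Real.sign_of_pos hy]
  · rw [Real.sign_of_neg hx, Real.sign_of_neg hy]

theorem abs_add_four_eq_of_sign_eq {x y z w : ℝ} (hxy : Real.sign x = Real.sign y)
    (hyz : Real.sign y = Real.sign z) (hzw : Real.sign z = Real.sign w) :
    |x + y + z + w| = |x| + |y| + |z| + |w| := by
  rcases lt_trichotomy w 0 with hw | hw | hw
  · rw [Real.sign_of_neg hw] at hzw
    have neg_of_sign {v : ℝ} (hv : Real.sign v = -1) : v < 0 := by
      by_contra! h0
      rcases h0.lt_or_eq with h0 | h0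
      · rw [Real.sign_of_pos h0] at hv
        linarith
      · simp [← h0] at hv
    have hx := neg_of_sign (hxy.trans (hyz.trans hzw))
    have hy := neg_of_sign (hyz.trans hzw)
    have hz := neg_of_sign hzw
    rw [abs_of_neg hx, abs_of_neg hy, abs_of_neg hz, abs_of_neg hw, abs_of_neg (by linarith)]
    ring
  · rw [hw, Real.sign_zero] at hzw
    simp [Real.sign_eq_zero_iff.mp hzw, Real.sign_eq_zero_iff.mp (hyz.trans hzw),
      Real.sign_eq_zero_iff.mp (hxy.trans (hyz.trans hzw)), hw]
  · rw [Real.sign_of_pos hw] at hzw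
    have pos_of_sign {v : ℝ} (hv : Real.sign v = 1) : 0 < v := by
      by_contra! h0
      rcases h0.lt_or_eq with h0 | h0
      · rw [Real.sign_of_neg h0] at hv
        linarith
      · simp [h0] at hv
    have hx := pos_of_sign (hxy.trans (hyz.trans hzw))
    have hy := pos_of_sign (hyz.trans hzw)
    have hz := pos_of_sign hzw
    rw [abs_of_pos hx, abs_of_pos hy, abs_of_pos hz, abs_of_pos hw, abs_of_pos (by linarith)]

/-- For `k ≥ |α|`, the gap condition GC1 holds iff all cotangents have the sign of `α` and
`|tan({a·k/π}·π/2)| + |tan({b·k/π}·π/2)| + |tan({c·k/π}·π/2)| < |α|/k`, where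
`{x} = x − round x` is the signed distance to the nearest integer. -/
theorem GC1_characterization (a b c k α : ℝ) (ha : 0 < a) (hb : 0 < b) (hc : 0 < c)
    (hk : 0 < k) (hkα : k ≥ |α|)
    (hsa : Real.sin (a * k) ≠ 0) (hsb : Real.sin (b * k) ≠ 0) (hsc : Real.sin (c * k) ≠ 0) :
    (|Real.cot (a * k) + Real.cot (b * k) + Real.cot (c * k) + α / k|
        > 1 / |Real.sin (a * k)| + 1 / |Real.sin (b * k)| + 1 / |Real.sin (c * k)|)
    ↔ ((Real.sign (Real.cot (a * k)) = Real.sign (Real.cot (b * k)) ∧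
        Real.sign (Real.cot (b * k)) = Real.sign (Real.cot (c * k)) ∧
        Real.sign (Real.cot (c * k)) = Real.sign α) ∧
       |Real.tan ((a * k / π - round (a * k / π)) * (π / 2))|
        + |Real.tan ((b * k / π - round (b * k / π)) * (π / 2))|
        + |Real.tan ((c * k / π - round (c * k / π)) * (π / 2))| < |α| / k) := by
  obtain ⟨hs, hxs, hxd⟩ := abs_tan_half_reduced hsa
  obtain ⟨ht, hyt, hyd⟩ := abs_tan_half_reduced hsb
  obtain ⟨hu, hzu, hzd⟩ := abs_tan_half_reduced hsc
  rw [hxd, hyd, hzd]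
  generalize |Real.tan ((a * k / π - round (a * k / π)) * (π / 2))| = s at *
  generalize |Real.tan ((b * k / π - round (b * k / π)) * (π / 2))| = t at *
  generalize |Real.tan ((c * k / π - round (c * k / π)) * (π / 2))| = u at *
  generalize Real.cot (a * k) = x at *
  generalize Real.cot (b * k) = y at *
  generalize Real.cot (c * k) = z at *
  have hβ : |α / k| = |α| / k := by rw [abs_div, abs_of_pos hk]
  have hβ1 : |α / k| ≤ 1 := by rw [hβ, div_le_one hk]; exact hkα
  have hsign : Real.sign (α / k) = Real.sign α := by
    rcases lt_trichotomy α 0 with h | h | h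
    · rw [Real.sign_of_neg h, Real.sign_of_neg (div_neg_of_neg_of_pos h hk)]
    · simp [h]
    · rw [Real.sign_of_pos h, Real.sign_of_pos (div_pos h hk)]
  rw [← hβ, ← hsign]
  generalize α / k = β at *
  constructor
  · intro h
    have hx : 0 < x * β := mul_pos_of_lt_abs_add (y := y + z) hs hxs hβ1 (abs_add_le y z)
      (add_pos ht hu) (by rw [← add_assoc x y z]; linarith)
    have hy : 0 < y * β := mul_pos_of_lt_abs_add (y := x + z) ht hyt hβ1 (abs_add_le x z)
      (add_pos hs hu) (by rw [← add_assoc y x z, add_comm y x]; linarith)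
    have hz : 0 < z * β := mul_pos_of_lt_abs_add (y := x + y) hu hzu hβ1 (abs_add_le x y)
      (add_pos hs ht) (by rw [add_comm z (x + y)]; linarith)
    have ex := sign_eq_sign_of_mul_pos hx
    have ey := sign_eq_sign_of_mul_pos hy
    have ez := sign_eq_sign_of_mul_pos hz
    refine ⟨⟨ex.trans ey.symm, ey.trans ez.symm, ez⟩, ?_⟩
    linarith [abs_add_le (x + y + z) β, abs_add_three x y z]
  · rintro ⟨⟨hxy, hyz, hzβ⟩, h⟩
    rw [abs_add_four_eq_of_sign_eq hxy hyz hzβ]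
    linarith
end

section
/- Let N ≥ 2 and let x₁, x₂, …, x_N be real numbers, all greater than or equal to one, satisfying x₁ > x₂ + ⋯ + x_N. Then x₁ − Σ_{i=2}^{N} x_i < √(x₁² − 1) − Σ_{i=2}^{N} √(x_i² − 1). -/
open Real Finset

theorem sqrt_sq_sub_one_le_self {a : ℝ} (ha : 0 ≤ a) : √(a ^ 2 - 1) ≤ a :=
  Real.sqrt_le_iff.mpr ⟨ha, by linarith⟩

theorem strictAntiOn_sub_sqrt_sq_sub_one :
    StrictAntiOn (fun t : ℝ => t - √(t ^ 2 - 1)) (Set.Ici 1) := by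
  intro a ha b hb hab
  simp only [Set.mem_Ici] at ha hb
  have hs : √(a ^ 2 - 1) ^ 2 = a ^ 2 - 1 := Real.sq_sqrt (by nlinarith)
  have ht : √(b ^ 2 - 1) ^ 2 = b ^ 2 - 1 := Real.sq_sqrt (by nlinarith)
  have hsa : √(a ^ 2 - 1) ≤ a := sqrt_sq_sub_one_le_self (by linarith)
  have htb : √(b ^ 2 - 1) < b := (Real.sqrt_lt' (by linarith)).mpr (by linarith)
  have hs0 := Real.sqrt_nonneg (a ^ 2 - 1)
  have ht0 : 0 < √(b ^ 2 - 1) := Real.sqrt_pos.mpr (by nlinarith)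
  by_contra! hle
  have h₁ : 0 ≤ (b - a - (√(b ^ 2 - 1) - √(a ^ 2 - 1))) * (√(b ^ 2 - 1) + √(a ^ 2 - 1)) :=
    mul_nonneg (by linarith) (by linarith)
  have h₂ : 0 < (b - a) * (b + a - (√(b ^ 2 - 1) + √(a ^ 2 - 1))) :=
    mul_pos (by linarith) (by linarith)
  nlinarith

/-- If `x 1, …, x N ≥ 1` and `x 1 > x 2 + ⋯ + x N`, then
`x 1 − ∑_{i=2}^{N} x i < √((x 1)² − 1) − ∑_{i=2}^{N} √((x i)² − 1)`. -/
theorem sqrt_inequality (N : ℕ) (hN : 2 ≤ N) (x : ℕ → ℝ)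
    (hx : ∀ i ∈ Finset.Icc 1 N, 1 ≤ x i)
    (h : x 1 > ∑ i ∈ Finset.Icc 2 N, x i) :
    x 1 - ∑ i ∈ Finset.Icc 2 N, x i
      < Real.sqrt ((x 1) ^ 2 - 1) - ∑ i ∈ Finset.Icc 2 N, Real.sqrt ((x i) ^ 2 - 1) := by
  have mem_two : 2 ∈ Finset.Icc 2 N := Finset.mem_Icc.mpr ⟨le_rfl, hN⟩
  have one_le : ∀ i ∈ Finset.Icc 2 N, 1 ≤ x i := fun i hi =>
    hx i (Finset.Icc_subset_Icc_left one_le_two hi)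
  have le_sum : x 2 ≤ ∑ i ∈ Finset.Icc 2 N, x i :=
    Finset.single_le_sum (fun i hi => zero_le_one.trans (one_le i hi)) mem_two
  have lt_two : x 1 - √(x 1 ^ 2 - 1) < x 2 - √(x 2 ^ 2 - 1) :=
    strictAntiOn_sub_sqrt_sq_sub_one (one_le 2 mem_two)
      (hx 1 (Finset.mem_Icc.mpr ⟨le_rfl, by lia⟩)) (le_sum.trans_lt h)
  have le_sum_sub : x 2 - √(x 2 ^ 2 - 1) ≤ ∑ i ∈ Finset.Icc 2 N, (x i - √(x i ^ 2 - 1)) :=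
    Finset.single_le_sum (f := fun i => x i - √(x i ^ 2 - 1))
      (fun i hi => sub_nonneg.mpr
        (sqrt_sq_sub_one_le_self (zero_le_one.trans (one_le i hi)))) mem_two
  rw [Finset.sum_sub_distrib] at le_sum_sub
  linarith
end

section
/- Let k > 0, let ℓ₁, ℓ₂, ℓ₃ > 0 with sin(ℓ₁·k) ≠ 0, sin(ℓ₂·k) ≠ 0, sin(ℓ₃·k) ≠ 0, and let α ∈ ℝ. If 1/|sin(ℓ₁·k)| > 1/|sin(ℓ₂·k)| + 1/|sin(ℓ₃·k)| and α·cot(ℓ₁·k) ≥ 0, then 1/|sin(ℓ₁·k)| − 1/|sin(ℓ₂·k)| − 1/|sin(ℓ₃·k)| ≤ |cot(ℓ₁·k) + cot(ℓ₂·k) + cot(ℓ₃·k) + α/k|. -/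
open Real

/-- The reciprocal of `|sin x|` is the positive square root of `1 + cot x ^ 2`. -/
lemma one_div_abs_sin_sq {x : ℝ} (hx : Real.sin x ≠ 0) :
    (1 / |Real.sin x|) ^ 2 = 1 + Real.cot x ^ 2 := by
  rw [div_pow, sq_abs, Real.cot_eq_cos_div_sin]
  field_simp
  linarith [Real.sin_sq_add_cos_sq x]

/-- Points `(c, s)`, `(d, t)` on the upper branch of the hyperbola `s ^ 2 = 1 + c ^ 2` with
`t ≤ s` and `0 ≤ c` satisfy `s - c ≤ t + d`. -/
lemma sub_le_add_of_sq_eq_one_add_sq {s c t d : ℝ} (ht : 0 < t) (hsc : s ^ 2 = 1 + c ^ 2)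
    (htd : t ^ 2 = 1 + d ^ 2) (hts : t ≤ s) (hc : 0 ≤ c) : s - c ≤ t + d := by
  have hdc : |d| ≤ c := abs_le_of_sq_le_sq (by nlinarith) hc
  have hd : |d| < t := abs_lt_of_sq_lt_sq (by linarith) ht.le
  obtain ⟨hd₁, hd₂⟩ := abs_le.mp hdc
  obtain ⟨hd₃, hd₄⟩ := abs_lt.mp hd
  by_contra! h
  nlinarith [mul_pos (sub_pos.mpr hd₄) (sub_pos.mpr h),
    mul_nonneg (show 0 ≤ s - c by linarith) (show 0 ≤ s + c - (t - d) by linarith)]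

/-- On the hyperbola `s ^ 2 = 1 + c ^ 2`, a dominant point with `c₁ ≥ 0` satisfies
`s₁ - s₂ - s₃ ≤ c₁ + c₂ + c₃`. -/
lemma sub_sub_le_add_add_of_sq_eq_one_add_sq {s₁ s₂ s₃ c₁ c₂ c₃ : ℝ} (hs₂ : 0 < s₂)
    (hs₃ : 0 < s₃) (h₁ : s₁ ^ 2 = 1 + c₁ ^ 2) (h₂ : s₂ ^ 2 = 1 + c₂ ^ 2)
    (h₃ : s₃ ^ 2 = 1 + c₃ ^ 2) (h : s₂ + s₃ < s₁) (hc : 0 ≤ c₁) :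
    s₁ - s₂ - s₃ ≤ c₁ + c₂ + c₃ := by
  have h₁₂ := sub_le_add_of_sq_eq_one_add_sq hs₂ h₁ h₂ (by linarith) hc
  have h₃' : |c₃| < s₃ := abs_lt_of_sq_lt_sq (by linarith) hs₃.le
  linarith [(abs_lt.mp h₃').1]

/-- If `1/|sin(ℓ₁·k)| > 1/|sin(ℓ₂·k)| + 1/|sin(ℓ₃·k)|` and `α·cot(ℓ₁·k) ≥ 0`, then
`1/|sin(ℓ₁·k)| − 1/|sin(ℓ₂·k)| − 1/|sin(ℓ₃·k)| ≤ |cot(ℓ₁·k) + cot(ℓ₂·k) + cot(ℓ₃·k) + α/k|`. -/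
theorem GC2_sign_obstruction (k ℓ₁ ℓ₂ ℓ₃ α : ℝ) (hk : 0 < k)
    (h₁ : 0 < ℓ₁) (h₂ : 0 < ℓ₂) (h₃ : 0 < ℓ₃)
    (hs₁ : Real.sin (ℓ₁ * k) ≠ 0) (hs₂ : Real.sin (ℓ₂ * k) ≠ 0) (hs₃ : Real.sin (ℓ₃ * k) ≠ 0)
    (hbig : 1 / |Real.sin (ℓ₁ * k)| > 1 / |Real.sin (ℓ₂ * k)| + 1 / |Real.sin (ℓ₃ * k)|)
    (hαcot : α * Real.cot (ℓ₁ * k) ≥ 0) :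
    1 / |Real.sin (ℓ₁ * k)| - 1 / |Real.sin (ℓ₂ * k)| - 1 / |Real.sin (ℓ₃ * k)|
      ≤ |Real.cot (ℓ₁ * k) + Real.cot (ℓ₂ * k) + Real.cot (ℓ₃ * k) + α / k| := by
  have p₂ : 0 < 1 / |Real.sin (ℓ₂ * k)| := by positivity
  have p₃ : 0 < 1 / |Real.sin (ℓ₃ * k)| := by positivity
  have q₁ := one_div_abs_sin_sq hs₁
  have q₂ := one_div_abs_sin_sq hs₂
  have q₃ := one_div_abs_sin_sq hs₃
  have one_le₂ : 1 ≤ 1 / |Real.sin (ℓ₂ * k)| :=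
    (one_le_div (abs_pos.mpr hs₂)).mpr (Real.abs_sin_le_one _)
  have hc : Real.cot (ℓ₁ * k) ≠ 0 := by
    intro h
    rw [h] at q₁
    nlinarith
  rcases hc.lt_or_gt with hc | hc
  · have hα : α / k ≤ 0 :=
      div_nonpos_of_nonpos_of_nonneg (nonpos_of_mul_nonneg_left hαcot hc) hk.le
    have key := sub_sub_le_add_add_of_sq_eq_one_add_sq (c₁ := -Real.cot (ℓ₁ * k))
      (c₂ := -Real.cot (ℓ₂ * k)) (c₃ := -Real.cot (ℓ₃ * k)) p₂ p₃
      (by rw [neg_sq, q₁]) (by rw [neg_sq, q₂]) (by rw [neg_sq, q₃]) hbig (by linarith)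
    exact le_trans (by linarith) (neg_le_abs _)
  · have hα : 0 ≤ α / k := div_nonneg (nonneg_of_mul_nonneg_left hαcot hc) hk.le
    have key := sub_sub_le_add_add_of_sq_eq_one_add_sq p₂ p₃ q₁ q₂ q₃ hbig hc.le
    exact le_trans (by linarith) (le_abs_self _)
end

section
/- Let a, b > 0 with a/b ∈ ℚ and let α ∈ ℝ, α ≠ 0. Then for every K > 0 there exists k > K with sin(a·k) ≠ 0 and sin(b·k) ≠ 0 such that the gap condition GC1 holds: |cot(a·k) + 2·cot(b·k) + α/k| > 1/|sin(a·k)| + 2/|sin(b·k)|. (Hence GC1 generates infinitely many gaps in the spectrum of the honeycomb-lattice Hamiltonian with edge lengths a, b, b.) -/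
open Real

/-- The half-angle identity `cot x = 1 / sin x - tan (x / 2)`. -/
theorem Real.cot_eq_one_div_sin_sub_tan_half {x : ℝ} (h0 : 0 < x) (h1 : x < π) :
    Real.cot x = 1 / Real.sin x - Real.tan (x / 2) := by
  have hs : 0 < Real.sin (x / 2) := Real.sin_pos_of_pos_of_lt_pi (by linarith) (by linarith)
  have hc : 0 < Real.cos (x / 2) := Real.cos_pos_of_mem_Ioo ⟨by linarith, by linarith⟩
  have hx : x = 2 * (x / 2) := by ring
  rw [Real.cot_eq_cos_div_sin, Real.tan_eq_sin_div_cos]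
  conv_lhs => rw [hx, Real.sin_two_mul, Real.cos_two_mul]
  conv_rhs => rw [hx, Real.sin_two_mul, ← hx]
  field_simp
  linarith [Real.sin_sq_add_cos_sq (x / 2)]

/-- The gap inequality on a right neighbourhood of zero, with `α / k` replaced by a constant. -/
theorem exists_gap_near_zero {a b ε : ℝ} (ha : 0 < a) (hb : 0 < b) (hε : 0 < ε) :
    ∃ t, 0 < t ∧ t < 1 ∧ 0 < Real.sin (a * t) ∧ 0 < Real.sin (b * t) ∧
      1 / Real.sin (a * t) + 2 / Real.sin (b * t)
        < Real.cot (a * t) + 2 * Real.cot (b * t) + ε := by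
  have hcont : ContinuousAt (fun t : ℝ => Real.tan (a * t / 2) + 2 * Real.tan (b * t / 2)) 0 := by
    have h (c : ℝ) : ContinuousAt (fun t : ℝ => Real.tan (c * t / 2)) 0 :=
      ContinuousAt.comp (g := Real.tan) (f := fun t : ℝ => c * t / 2)
        (Real.continuousAt_tan.2 (by simp)) (by fun_prop)
    exact (h a).add (continuousAt_const.mul (h b))
  have hsmall : ∀ᶠ t in nhds (0 : ℝ),
      Real.tan (a * t / 2) + 2 * Real.tan (b * t / 2) < ε :=
    hcont.eventually_lt continuousAt_const (by simpa using hε)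
  have hlt (c d : ℝ) (hd : 0 < d) : ∀ᶠ t in nhds (0 : ℝ), c * t < d :=
    (by fun_prop : ContinuousAt (fun t : ℝ => c * t) 0).eventually_lt continuousAt_const
      (by simpa using hd)
  have hall := (hsmall.and ((hlt a π pi_pos).and ((hlt b π pi_pos).and (hlt 1 1 one_pos))))
  obtain ⟨t, ⟨h, h₁, h₂, h₃⟩, ht⟩ :=
    ((hall.filter_mono nhdsWithin_le_nhds).and
      (self_mem_nhdsWithin : Set.Ioi (0 : ℝ) ∈ nhdsWithin 0 (Set.Ioi 0))).exists
  have ht : 0 < t := ht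
  refine ⟨t, ht, by linarith, Real.sin_pos_of_pos_of_lt_pi (by positivity) h₁,
    Real.sin_pos_of_pos_of_lt_pi (by positivity) h₂, ?_⟩
  rw [Real.cot_eq_one_div_sin_sub_tan_half (by positivity) h₁,
    Real.cot_eq_one_div_sin_sub_tan_half (by positivity) h₂]
  have : 2 / Real.sin (b * t) = 2 * (1 / Real.sin (b * t)) := by ring
  linarith

/-- Commensurate lengths have arbitrarily large common periods. -/
theorem exists_large_common_period {a b : ℝ} (hb : 0 < b) (hrat : ∃ r : ℚ, a / b = (r : ℝ))
    (K : ℝ) : ∃ k > K, ∃ m n : ℤ, a * k = m * (2 * π) ∧ b * k = n * (2 * π) := by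
  obtain ⟨r, hr⟩ := hrat
  have hden : (0 : ℝ) < r.den := by exact_mod_cast r.den_pos
  have hpos : 0 < 2 * π * r.den / b := by positivity
  obtain ⟨N, hN⟩ := exists_nat_gt (K / (2 * π * r.den / b))
  refine ⟨N * (2 * π * r.den / b), (div_lt_iff₀ hpos).1 hN, r.num * N, r.den * N, ?_, ?_⟩
  · have hnum : (r : ℝ) * r.den = r.num := by exact_mod_cast Rat.mul_den_eq_num r
    push_cast
    rw [← hnum, ← hr]
    field_simp
  · push_cast
    field_simp

/-- If `a/b ∈ ℚ` and `α ≠ 0`, the gap condition GC1 (for the lattice with `b = c`) is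
satisfied for arbitrarily large `k`. -/
theorem GC1_infinitely_many_gaps_rational (a b α : ℝ) (ha : 0 < a) (hb : 0 < b)
    (hrat : ∃ r : ℚ, a / b = (r : ℝ)) (hα : α ≠ 0) :
    ∀ K > 0, ∃ k > K, Real.sin (a * k) ≠ 0 ∧ Real.sin (b * k) ≠ 0 ∧
      |Real.cot (a * k) + 2 * Real.cot (b * k) + α / k|
        > 1 / |Real.sin (a * k)| + 2 / |Real.sin (b * k)| := by
  intro K hK
  obtain ⟨k₀, hk₀, m, n, hm, hn⟩ := exists_large_common_period hb hrat (K + 1)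
  have hε : 0 < |α| / (k₀ + 1) := div_pos (abs_pos.2 hα) (by linarith)
  obtain ⟨t, ht, ht₁, hsa, hsb, hgap⟩ := exists_gap_near_zero ha hb hε
  have hle (k : ℝ) (h0 : 0 < k) (h : k ≤ k₀ + 1) : |α| / (k₀ + 1) ≤ |α| / k := by gcongr
  rcases hα.lt_or_gt with hneg | hpos
  · have ea : a * (k₀ - t) = -(a * t) + m * (2 * π) := by rw [← hm]; ring
    have eb : b * (k₀ - t) = -(b * t) + n * (2 * π) := by rw [← hn]; ring
    refine ⟨k₀ - t, by linarith, ?_⟩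
    have h := hle (k₀ - t) (by linarith) (by linarith)
    rw [abs_of_neg hneg, neg_div, neg_div] at h
    rw [abs_of_neg hneg, neg_div] at hgap
    simp only [Real.cot_eq_cos_div_sin] at hgap ⊢
    rw [ea, eb]
    simp only [Real.sin_add_int_mul_two_pi, Real.cos_add_int_mul_two_pi, Real.sin_neg,
      Real.cos_neg, abs_neg, div_neg, abs_of_pos hsa, abs_of_pos hsb]
    refine ⟨neg_ne_zero.2 hsa.ne', neg_ne_zero.2 hsb.ne', lt_of_lt_of_le ?_ (neg_le_abs _)⟩
    linarith
  · have ea : a * (k₀ + t) = a * t + m * (2 * π) := by rw [← hm]; ring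
    have eb : b * (k₀ + t) = b * t + n * (2 * π) := by rw [← hn]; ring
    refine ⟨k₀ + t, by linarith, ?_⟩
    have h := hle (k₀ + t) (by linarith) (by linarith)
    rw [abs_of_pos hpos] at h hgap
    simp only [Real.cot_eq_cos_div_sin] at hgap ⊢
    rw [ea, eb]
    simp only [Real.sin_add_int_mul_two_pi, Real.cos_add_int_mul_two_pi, abs_of_pos hsa,
      abs_of_pos hsb]
    refine ⟨hsa.ne', hsb.ne', lt_of_lt_of_le ?_ (le_abs_self _)⟩
    linarith
end

section
/- Let a, b > 0 be such that θ = a/b is a Last admissible irrational number, and let α ∈ ℝ, α ≠ 0. Then for every K > 0 there exists k > K with sin(a·k) ≠ 0 and sin(b·k) ≠ 0 such that the gap condition GC1 holds: |cot(a·k) + 2·cot(b·k) + α/k| > 1/|sin(a·k)| + 2/|sin(b·k)|. (Hence GC1 generates infinitely many gaps in the spectrum of the honeycomb-lattice Hamiltonian with edge lengths a, b, b.) -/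
open Real Filter

/-- A `θ ∈ ℝ` is Last admissible if it is irrational and there are strictly increasing
sequences of positive integers `pₙ`, `qₙ` with `qₙ² · |θ − pₙ/qₙ| → 0`. -/
def LastAdmissible (θ : ℝ) : Prop :=
  Irrational θ ∧ ∃ p q : ℕ → ℕ, StrictMono p ∧ StrictMono q ∧
    (∀ n, 0 < p n) ∧ (∀ n, 0 < q n) ∧
    Filter.Tendsto (fun n => (q n : ℝ) ^ 2 * |θ - (p n : ℝ) / (q n : ℝ)|) atTop (nhds 0)

/-- On `(0, 1]`, `1 / sin x` exceeds `cot x` by at most `x`. -/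
lemma inv_sin_le_cot_add {x : ℝ} (hx : 0 < x) (hx1 : x ≤ 1) :
    1 / Real.sin x ≤ Real.cot x + x := by
  have hs : x - x ^ 3 / 6 < Real.sin x := Real.sin_gt_sub_cube hx
  have hc : 1 - x ^ 2 / 2 ≤ Real.cos x := Real.one_sub_sq_div_two_le_cos
  have hpos : 0 < Real.sin x :=
    Real.sin_pos_of_pos_of_lt_pi hx (by linarith [Real.pi_gt_three])
  rw [Real.cot_eq_cos_div_sin, div_add' _ _ _ hpos.ne']
  gcongr
  have h4 : x ^ 4 ≤ x ^ 2 := pow_le_pow_of_le_one hx.le hx1 (by norm_num)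
  nlinarith [mul_lt_mul_of_pos_left hs hx]

lemma cot_add_nat_mul_pi (x : ℝ) (n : ℕ) : Real.cot (x + n * π) = Real.cot x := by
  rw [← Real.tan_inv_eq_cot, ← Real.tan_inv_eq_cot, Real.tan_add_nat_mul_pi]

lemma abs_sin_add_nat_mul_pi (x : ℝ) (n : ℕ) :
    |Real.sin (x + n * π)| = |Real.sin x| := by
  rw [Real.sin_add_nat_mul_pi, abs_mul, abs_pow, abs_neg, abs_one, one_pow, one_mul]

lemma cot_sign_mul {s : ℝ} (hs : s = 1 ∨ s = -1) (x : ℝ) :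
    Real.cot (s * x) = s * Real.cot x := by
  rcases hs with rfl | rfl <;> simp [Real.cot_eq_cos_div_sin, div_neg]

lemma abs_sin_sign_mul {s : ℝ} (hs : s = 1 ∨ s = -1) (x : ℝ) :
    |Real.sin (s * x)| = |Real.sin x| := by
  rcases hs with rfl | rfl <;> simp

/-- The gap inequality near a common approximate pole, with both arguments displaced from
multiples of `π` in the direction `s` of the sign of the coupling term. -/
lemma gap_of_displacement {s x y A u v : ℝ} {m n : ℕ} (hs : s = 1 ∨ s = -1)
    (hx : 0 < x) (hx1 : x ≤ 1) (hy : 0 < y) (hy1 : y ≤ 1) (hA : x + 2 * y < A)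
    (hu : u = s * x + m * π) (hv : v = s * y + n * π) :
    Real.sin u ≠ 0 ∧ Real.sin v ≠ 0 ∧
      |Real.cot u + 2 * Real.cot v + s * A| > 1 / |Real.sin u| + 2 / |Real.sin v| := by
  have hsx : 0 < Real.sin x :=
    Real.sin_pos_of_pos_of_lt_pi hx (by linarith [Real.pi_gt_three])
  have hsy : 0 < Real.sin y :=
    Real.sin_pos_of_pos_of_lt_pi hy (by linarith [Real.pi_gt_three])
  have hsu : |Real.sin u| = Real.sin x := by
    rw [hu, abs_sin_add_nat_mul_pi, abs_sin_sign_mul hs, abs_of_pos hsx]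
  have hsv : |Real.sin v| = Real.sin y := by
    rw [hv, abs_sin_add_nat_mul_pi, abs_sin_sign_mul hs, abs_of_pos hsy]
  refine ⟨abs_pos.mp (hsu ▸ hsx), abs_pos.mp (hsv ▸ hsy), ?_⟩
  have habs : |s| = 1 := by rcases hs with rfl | rfl <;> simp
  rw [hsu, hsv, hu, hv, cot_add_nat_mul_pi, cot_add_nat_mul_pi, cot_sign_mul hs,
    cot_sign_mul hs, show s * Real.cot x + 2 * (s * Real.cot y) + s * A
      = s * (Real.cot x + 2 * Real.cot y + A) by ring, abs_mul, habs, one_mul]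
  have h1 := inv_sin_le_cot_add hx hx1
  have h2 := inv_sin_le_cot_add hy hy1
  have h3 : 2 / Real.sin y = 2 * (1 / Real.sin y) := by ring
  have h4 := le_abs_self (Real.cot x + 2 * Real.cot y + A)
  linarith

/-- If `a/b` is a Last admissible irrational number and `α ≠ 0`, the gap condition GC1
(for the lattice with `b = c`) is satisfied for arbitrarily large `k`. -/
theorem GC1_infinitely_many_gaps_last_admissible (a b α : ℝ) (ha : 0 < a) (hb : 0 < b)
    (hla : LastAdmissible (a / b)) (hα : α ≠ 0) :
    ∀ K > 0, ∃ k > K, Real.sin (a * k) ≠ 0 ∧ Real.sin (b * k) ≠ 0 ∧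
      |Real.cot (a * k) + 2 * Real.cot (b * k) + α / k|
        > 1 / |Real.sin (a * k)| + 2 / |Real.sin (b * k)| := by
  intro K hK
  obtain ⟨hirr, p, q, -, hq, -, hq0, hlim⟩ := hla
  set θ := a / b with hθ
  have hθ0 : 0 < θ := div_pos ha hb
  have hab : a = θ * b := by rw [hθ]; field_simp
  have small : ∀ C c : ℝ, 0 < c →
      ∀ᶠ n in atTop, C * ((q n : ℝ) ^ 2 * |θ - (p n : ℝ) / (q n : ℝ)|) < c := fun C c hc =>
    (hlim.const_mul C).eventually_lt_const (by simpa using hc)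
  have hqtop : Tendsto (fun n => (q n : ℝ)) atTop atTop :=
    tendsto_natCast_atTop_atTop.comp hq.tendsto_atTop
  obtain ⟨n, h1, h2, h3, h4⟩ := ((small (3 * π) 1 one_pos).and ((small (2 * π / θ) 1 one_pos).and
    ((small ((3 + 4 / θ) * π * (2 * π / b)) |α| (abs_pos.mpr hα)).and
      (hqtop.eventually_gt_atTop (K * b + 1))))).exists
  have hq1 : (1 : ℝ) ≤ q n := by exact_mod_cast hq0 n
  have hqpos : (0 : ℝ) < q n := by linarith
  set e := (q n : ℝ) ^ 2 * |θ - (p n : ℝ) / (q n : ℝ)| with he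
  set δ := π * (q n * θ - p n) with hδ
  have hδe : q n * |δ| = π * e := by
    have h : δ = π * (q n * (θ - p n / q n)) := by rw [hδ]; field_simp
    rw [h, abs_mul, abs_mul, abs_of_pos pi_pos, abs_of_pos hqpos, he]
    ring
  have hδ0 : 0 < |δ| := by
    refine abs_pos.mpr (mul_ne_zero pi_ne_zero fun h => ?_)
    exact (hirr.natCast_mul (hq0 n).ne').ne_nat (p n) (sub_eq_zero.mp h)
  have hδle : |δ| ≤ π * e := by
    rw [← hδe]
    exact le_mul_of_one_le_left hδ0.le hq1
  obtain ⟨s, hs, hsα⟩ : ∃ s : ℝ, (s = 1 ∨ s = -1) ∧ α = s * |α| := by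
    rcases abs_choice α with h | h
    · exact ⟨1, Or.inl rfl, by rw [h, one_mul]⟩
    · exact ⟨-1, Or.inr rfl, by rw [h]; ring⟩
  have hss : s * s = 1 := by rcases hs with rfl | rfl <;> norm_num
  have hsδ : -|δ| ≤ s * δ ∧ s * δ ≤ |δ| := by
    refine abs_le.mp (le_of_eq ?_)
    rcases hs with rfl | rfl <;> simp
  set y := 2 * |δ| / θ with hy
  have hy0 : 0 < y := by positivity
  have hθy : θ * y = 2 * |δ| := by rw [hy]; field_simp
  have hy1 : y ≤ 1 := by
    calc y = 2 / θ * |δ| := by rw [hy]; ring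
      _ ≤ 2 / θ * (π * e) := by gcongr
      _ = 2 * π / θ * e := by ring
      _ ≤ 1 := h2.le
  have hsy : -1 ≤ s * y ∧ s * y ≤ 1 := by
    rcases hs with rfl | rfl <;> constructor <;> linarith
  set k := (π * q n + s * y) / b with hk
  have hbk : b * k = π * q n + s * y := by rw [hk]; field_simp
  have hπq : 3 * (q n : ℝ) ≤ π * q n := by gcongr; exact pi_gt_three.le
  have hkK : K < k := by
    rw [hk, lt_div_iff₀ hb]
    linarith [hsy.1]
  have hk0 : 0 < k := hK.trans hkK
  have hkle : k ≤ 2 * π / b * q n := by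
    rw [hk, div_mul_eq_mul_div]
    gcongr
    linarith [hsy.2]
  have hgap : (2 * |δ| + s * δ) + 2 * y < |α| / k := by
    rw [lt_div_iff₀ hk0]
    calc (2 * |δ| + s * δ + 2 * y) * k ≤ (2 * |δ| + |δ| + 2 * y) * (2 * π / b * q n) := by
          gcongr
          exact hsδ.2
      _ = (3 + 4 / θ) * (2 * π / b) * (q n * |δ|) := by rw [hy]; ring
      _ = (3 + 4 / θ) * π * (2 * π / b) * e := by rw [hδe]; ring
      _ < |α| := h3
  refine ⟨k, hkK, ?_⟩
  have hu : a * k = s * (2 * |δ| + s * δ) + p n * π := by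
    rw [hab, mul_assoc, hbk, ← hθy]
    linear_combination (-δ) * hss - hδ
  have hv : b * k = s * y + q n * π := by rw [hbk]; ring
  rw [show α / k = s * (|α| / k) by rw [← mul_div_assoc, ← hsα]]
  exact gap_of_displacement hs (by linarith [hsδ.1]) (by linarith [hsδ.2]) hy0 hy1 hgap hu hv
end

section
/- Let a, b > 0 be such that θ = a/b is a badly approximable irrational number, and let α ∈ ℝ satisfy |α| > (4π/√5)·min{2/a, 1/b}. Then for every K > 0 there exists k > K with sin(a·k) ≠ 0 and sin(b·k) ≠ 0 such that the gap condition GC1 holds: |cot(a·k) + 2·cot(b·k) + α/k| > 1/|sin(a·k)| + 2/|sin(b·k)|. (Hence GC1 generates infinitely many gaps in the spectrum of the honeycomb-lattice Hamiltonian with edge lengths a, b, b.) -/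
open Real

/-- A real number `θ` is badly approximable if there is `γ > 0` with `|θ − p/q| > γ/q²`
for all positive integers `p`, `q`. -/
def BadlyApproximable (θ : ℝ) : Prop :=
  Irrational θ ∧ ∃ γ : ℝ, 0 < γ ∧
    ∀ p q : ℕ, 0 < p → 0 < q → |θ - (p : ℝ) / (q : ℝ)| > γ / (q : ℝ) ^ 2

lemma exists_pos_le_mul_sub_int (θ : ℝ) (hθ : Irrational θ) (N : ℕ) :
    ∃ ε : ℝ, 0 < ε ∧ ∀ j m : ℤ, 0 < j → j ≤ N → 0 < (j : ℝ) * θ - m → ε ≤ (j : ℝ) * θ - m := by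
  induction N with
  | zero => exact ⟨1, one_pos, fun j m h1 h2 _ => by norm_cast at h2; omega⟩
  | succ N ih =>
    obtain ⟨ε, hε, h⟩ := ih
    have hirr : Irrational ((((N : ℤ) + 1 : ℤ) : ℝ) * θ) :=
      hθ.intCast_mul (by omega)
    refine ⟨min ε (Int.fract ((((N : ℤ) + 1 : ℤ) : ℝ) * θ)), lt_min hε ?_, ?_⟩
    · exact Int.fract_pos.2 (hirr.ne_int _)
    · intro j m hj hjN hpos
      rcases eq_or_ne j (N + 1) with rfl | hne
      · refine (min_le_right _ _).trans ?_
        have : m ≤ ⌊(((N : ℤ) + 1 : ℤ) : ℝ) * θ⌋ := Int.le_floor.2 (by linarith)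
        have : (m : ℝ) ≤ ⌊(((N : ℤ) + 1 : ℤ) : ℝ) * θ⌋ := by exact_mod_cast this
        rw [Int.fract]
        linarith
      · exact (min_le_left _ _).trans (h j m hj (by push_cast at hjN; omega) hpos)

/-- A rational `r > θ` yields integers `n`, `m` approximating `θ` from below at least as well. -/
lemma exists_int_mul_sub_lt_of_lt_rat (θ : ℝ) (r : ℚ) (δ : ℝ)
    (hδ : δ = (r.num : ℝ) - r.den * θ) (hδ0 : 0 < δ) (hδq : δ * r.den < 1) :
    ∃ n m : ℤ, 0 < n ∧ 0 < (n : ℝ) * θ - m ∧ (n : ℝ) * θ - m ≤ δ ∧ (n : ℝ) * θ - m < 1 / n := by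
  have hq : (0 : ℝ) < r.den := by exact_mod_cast r.den_pos
  obtain ⟨x, y, hxy⟩ : IsCoprime r.num (r.den : ℤ) := by
    rw [Int.isCoprime_iff_nat_coprime]
    exact r.reduced
  have hxy' : (x : ℝ) * r.num + y * r.den = 1 := by exact_mod_cast hxy
  set z : ℤ := ⌈(1 / δ - x) / r.den⌉ - 1 with hz
  have hz1 : (z : ℝ) < (1 / δ - x) / r.den := by
    have := Int.ceil_lt_add_one ((1 / δ - x) / r.den)
    rw [hz]; push_cast; linarith
  have hz2 : (1 / δ - x) / r.den ≤ z + 1 := by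
    have := Int.le_ceil ((1 / δ - x) / r.den)
    rw [hz]; push_cast; linarith
  rw [lt_div_iff₀ hq] at hz1
  rw [div_le_iff₀ hq] at hz2
  have hn1 : ((x : ℝ) + z * r.den) * δ < 1 := by
    rw [← lt_div_iff₀ hδ0]; linarith
  have hn2 : 1 ≤ ((x : ℝ) + z * r.den + r.den) * δ := by
    rw [← div_le_iff₀ hδ0]; linarith
  have hn0 : 0 < (x : ℝ) + z * r.den := by
    by_contra hneg
    push Not at hneg
    nlinarith
  have key : ((x : ℝ) + z * r.den) * θ - (-y + z * r.num)
      = (1 - (x + z * r.den) * δ) / r.den := by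
    rw [eq_div_iff hq.ne', hδ]
    linear_combination hxy'
  have hle : (1 - (x + z * r.den) * δ) / r.den ≤ δ := by
    rw [div_le_iff₀ hq]; linarith
  refine ⟨x + z * r.den, -y + z * r.num, by exact_mod_cast hn0, ?_, ?_, ?_⟩
  · push_cast
    rw [key]
    exact div_pos (by linarith) hq
  · push_cast
    rw [key]
    exact hle
  · push_cast
    rw [key]
    refine hle.trans_lt ?_
    rw [lt_div_iff₀ hn0]
    linarith

/-- One-sided Dirichlet approximation. -/
lemma exists_int_mul_sub_lt_one_div (θ : ℝ) (hθ : Irrational θ) (N : ℕ) :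
    ∃ n m : ℤ, (N : ℤ) < n ∧ 0 < (n : ℝ) * θ - m ∧ (n : ℝ) * θ - m < 1 / n := by
  obtain ⟨ε, hε, h⟩ := exists_pos_le_mul_sub_int θ hθ N
  obtain ⟨Q, hQ⟩ := exists_nat_one_div_lt hε
  obtain ⟨r, hr, hrQ⟩ := Real.exists_rat_abs_sub_le_and_den_le θ (Nat.succ_pos Q)
  have hq : (0 : ℝ) < r.den := by exact_mod_cast r.den_pos
  have hrQ' : (r.den : ℝ) ≤ Q + 1 := by exact_mod_cast hrQ
  have hQ0 : (0 : ℝ) < Q + 1 := by positivity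
  have hrd : (r : ℝ) = r.num / r.den := by exact_mod_cast (Rat.num_div_den r).symm
  have hval : (θ - r) * r.den = r.den * θ - r.num := by
    rw [hrd]; field_simp
  have habs : |r.den * θ - r.num| ≤ 1 / ((Q : ℝ) + 1 + 1) := by
    rw [← hval, abs_mul, abs_of_pos hq]
    calc _ ≤ 1 / (((Q.succ : ℝ) + 1) * r.den) * r.den := by gcongr
      _ = _ := by push_cast; field_simp
  have hlt : 1 / ((Q : ℝ) + 1 + 1) < 1 / (Q + 1) := by
    apply one_div_lt_one_div_of_lt <;> linarith
  have hltq : 1 / ((Q : ℝ) + 1 + 1) < 1 / r.den :=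
    hlt.trans_le (one_div_le_one_div_of_le hq hrQ')
  have hlarge : ∀ n m : ℤ, 0 < n → 0 < (n : ℝ) * θ - m → (n : ℝ) * θ - m < ε → (N : ℤ) < n := by
    intro n m hn h0 h1
    by_contra hle
    exact absurd (h n m hn (not_lt.1 hle) h0) (not_le.2 h1)
  have hne : (r.den : ℝ) * θ - r.num ≠ 0 := by
    rw [← hval]
    exact mul_ne_zero (sub_ne_zero.2 (hθ.ne_rat r)) hq.ne'
  rcases hne.lt_or_gt with hneg | hpos
  · rw [abs_of_neg hneg] at habs
    obtain ⟨n, m, hn, h0, h1, h2⟩ := exists_int_mul_sub_lt_of_lt_rat θ r _ rfl (by linarith)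
      (by rw [← lt_div_iff₀ hq]; linarith)
    exact ⟨n, m, hlarge n m hn h0 (by linarith), h0, h2⟩
  · rw [abs_of_pos hpos] at habs
    refine ⟨r.den, r.num, hlarge _ r.num (by exact_mod_cast r.den_pos) ?_ ?_, ?_, ?_⟩ <;>
      push_cast <;> linarith

lemma exists_int_sign_mul_sub_lt_one_div (θ : ℝ) (hθ : Irrational θ) (σ : ℝ)
    (hσ : σ = 1 ∨ σ = -1) (N : ℕ) :
    ∃ n m : ℤ, (N : ℤ) < n ∧ 0 < σ * ((n : ℝ) * θ - m) ∧ σ * ((n : ℝ) * θ - m) < 1 / n := by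
  rcases hσ with rfl | rfl
  · simpa using exists_int_mul_sub_lt_one_div θ hθ N
  · obtain ⟨n, m, hn, h0, h1⟩ := exists_int_mul_sub_lt_one_div (-θ) hθ.neg N
    refine ⟨n, -m, hn, ?_, ?_⟩ <;> push_cast <;> linarith

lemma one_div_abs_sin_add_int_mul_pi (m : ℤ) (s : ℝ) (hs0 : 0 < s) (hsπ : s < π) :
    sin (s + m * π) ≠ 0 ∧
      1 / |sin (s + m * π)| = cot (s + m * π) + tan (s / 2) := by
  have hsin : 0 < sin s := sin_pos_of_pos_of_lt_pi hs0 hsπ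
  have hu : ((-1 : ℝ) ^ m) ≠ 0 := zpow_ne_zero _ (by norm_num)
  have hsin2 : 0 < sin (s / 2) := sin_pos_of_pos_of_lt_pi (by linarith) (by linarith)
  have hcos2 : 0 < cos (s / 2) := cos_pos_of_mem_Ioo ⟨by linarith, by linarith⟩
  have hs : sin s = 2 * sin (s / 2) * cos (s / 2) := by rw [← sin_two_mul]; ring_nf
  have hc : cos s = 1 - 2 * sin (s / 2) ^ 2 := by
    have := cos_two_mul (s / 2)
    rw [mul_div_cancel₀ s two_ne_zero] at this
    rw [this, cos_sq']; ring
  rw [cot_eq_cos_div_sin, sin_add_int_mul_pi, cos_add_int_mul_pi,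
    mul_div_mul_left _ _ hu, abs_mul, abs_zpow, abs_neg, abs_one, one_zpow, one_mul,
    abs_of_pos hsin, tan_eq_sin_div_cos]
  refine ⟨mul_ne_zero hu hsin.ne', ?_⟩
  rw [hs, hc]
  field_simp
  ring

lemma one_div_abs_sin_eq_sign_mul_cot_add_tan (σ : ℝ) (hσ : σ = 1 ∨ σ = -1) (m : ℤ) (s x : ℝ)
    (hs0 : 0 < s) (hsπ : s < π) (hx : x = m * π + σ * s) :
    sin x ≠ 0 ∧ 1 / |sin x| = σ * cot x + tan (s / 2) := by
  rcases hσ with rfl | rfl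
  · have := one_div_abs_sin_add_int_mul_pi m s hs0 hsπ
    rwa [show s + m * π = x by rw [hx]; ring, ← one_mul (cot x)] at this
  · have := one_div_abs_sin_add_int_mul_pi (-m) s hs0 hsπ
    rw [show s + ((-m : ℤ) : ℝ) * π = -x by rw [hx]; push_cast; ring, sin_neg, abs_neg,
      cot_eq_cos_div_sin, sin_neg, cos_neg, div_neg, ← cot_eq_cos_div_sin] at this
    exact ⟨neg_ne_zero.1 this.1, by rw [this.2]; ring⟩

lemma tan_le_mul_of_le {x : ℝ} (h0 : 0 ≤ x) (h1 : x ≤ 0.4) : tan x ≤ 1.1 * x := by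
  have hc := one_sub_sq_div_two_le_cos (x := x)
  have hc' : 0.92 ≤ cos x := by nlinarith
  rw [tan_eq_sin_div_cos, div_le_iff₀ (by linarith)]
  nlinarith [sin_le h0]

lemma exists_tan_add_tan_lt (u v w w' A σ : ℝ) (hu : 0 < u) (hv : 0 < v) (hw : 0 < w)
    (hirr : Irrational (u / v)) (hσ : σ = 1 ∨ σ = -1)
    (hA : 1.1 * π ^ 2 / 2 * w < A * v) (K : ℝ) :
    ∃ k > K, ∃ (m n : ℤ) (s t : ℝ), 0 < s ∧ s < π ∧ 0 < t ∧ t < π ∧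
      u * k = m * π + σ * s ∧ v * k = n * π + σ * t ∧
      w * tan (s / 2) + w' * tan (t / 2) < A / k := by
  have hσσ : σ * σ = 1 := by rcases hσ with rfl | rfl <;> norm_num
  obtain ⟨N, hN⟩ := exists_nat_gt (max 4 (K * v / π))
  obtain ⟨n, m, hn, h0, h1⟩ := exists_int_sign_mul_sub_lt_one_div (u / v) hirr σ hσ N
  set d := σ * ((n : ℝ) * (u / v) - m) with hd
  have hnN : (N : ℝ) < n := by exact_mod_cast hn
  have hn4 : (4 : ℝ) < n := (le_max_left _ _).trans_lt (hN.trans hnN)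
  have hnK : K * v / π < n := (le_max_right _ _).trans_lt (hN.trans hnN)
  have hn0 : (0 : ℝ) < n := by linarith
  have hdn : d * n < 1 := by rwa [lt_div_iff₀ hn0] at h1
  have hd4 : d < 1 / 4 := by nlinarith
  have hπ := pi_pos
  have hπ' := pi_lt_d2
  have hx4 : π * d / 2 ≤ 0.4 := by nlinarith
  have htan := tan_le_mul_of_le (x := π * d / 2) (by positivity) hx4
  have hbase : w * tan (π * d / 2) < A / (n * π / v) := by
    rw [lt_div_iff₀ (by positivity)]
    calc w * tan (π * d / 2) * (n * π / v)
        ≤ w * (1.1 * (π * d / 2)) * (n * π / v) := by gcongr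
      _ = 1.1 * π ^ 2 / 2 * w * (d * n) / v := by ring
      _ ≤ 1.1 * π ^ 2 / 2 * w * 1 / v := by gcongr
      _ < A := by rw [div_lt_iff₀ hv]; linarith
  have hk0 : K < n * π / v := by
    rw [lt_div_iff₀ hv]; rwa [div_lt_iff₀ hπ] at hnK
  have hcos : cos ((π * d + u * 0) / 2) ≠ 0 :=
    (cos_pos_of_mem_Ioo ⟨by simp only [mul_zero, add_zero]; nlinarith,
      by simp only [mul_zero, add_zero]; nlinarith⟩).ne'
  have hk0' : (n * π / v + σ * 0 : ℝ) ≠ 0 := by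
    rw [mul_zero, add_zero]; positivity
  have hlim : ∀ᶠ η in nhds (0 : ℝ),
      w * tan ((π * d + u * η) / 2) + w' * tan (v * η / 2) < A / (n * π / v + σ * η) := by
    refine ContinuousAt.eventually_lt ?_ ?_ (by simpa using hbase)
    · refine (continuousAt_const.mul ?_).add (continuousAt_const.mul ?_)
      · exact ContinuousAt.comp (f := fun η : ℝ => (π * d + u * η) / 2)
          (continuousAt_tan.2 hcos) (by fun_prop)
      · exact ContinuousAt.comp (f := fun η : ℝ => v * η / 2)
          (continuousAt_tan.2 (by simp)) (by fun_prop)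
    · exact continuousAt_const.div (by fun_prop) hk0'
  have hkK : ∀ᶠ η in nhds (0 : ℝ), K < n * π / v + σ * η :=
    ContinuousAt.eventually_lt continuousAt_const (by fun_prop) (by simpa using hk0)
  have hs : ∀ᶠ η in nhds (0 : ℝ), π * d + u * η < π :=
    ContinuousAt.eventually_lt (by fun_prop) continuousAt_const
      (by simp only [mul_zero, add_zero]; nlinarith)
  have ht : ∀ᶠ η in nhds (0 : ℝ), v * η < π :=
    ContinuousAt.eventually_lt (by fun_prop) continuousAt_const (by simpa using hπ)
  obtain ⟨η, hη, hη1, hη2, hη3, hη4⟩ := ((eventually_mem_nhdsWithin (s := Set.Ioi (0 : ℝ))).and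
    (((hlim.and (hkK.and (hs.and ht)))).filter_mono nhdsWithin_le_nhds)).exists
  have hη0 : 0 < η := hη
  refine ⟨n * π / v + σ * η, hη2, m, n, π * d + u * η, v * η, by positivity, hη3, by positivity,
    hη4, ?_, ?_, hη1⟩
  · rw [hd]
    have : σ * (π * (σ * (n * (u / v) - m))) = σ * σ * (π * (n * (u / v) - m)) := by ring
    rw [mul_add, mul_add, this, hσσ]
    ring
  · field_simp

lemma gap_condition_of_tan_add_tan_lt (a b α σ k s t : ℝ) (m n : ℤ)
    (hσ : σ = 1 ∨ σ = -1) (hσα : σ * α = |α|)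
    (hs0 : 0 < s) (hsπ : s < π) (ht0 : 0 < t) (htπ : t < π)
    (hs : a * k = m * π + σ * s) (ht : b * k = n * π + σ * t)
    (h : tan (s / 2) + 2 * tan (t / 2) < |α| / k) :
    sin (a * k) ≠ 0 ∧ sin (b * k) ≠ 0 ∧
      |cot (a * k) + 2 * cot (b * k) + α / k| > 1 / |sin (a * k)| + 2 / |sin (b * k)| := by
  obtain ⟨h1, h2⟩ := one_div_abs_sin_eq_sign_mul_cot_add_tan σ hσ m s (a * k) hs0 hsπ hs
  obtain ⟨h3, h4⟩ := one_div_abs_sin_eq_sign_mul_cot_add_tan σ hσ n t (b * k) ht0 htπ ht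
  refine ⟨h1, h3, ?_⟩
  have hσabs : |σ| = 1 := by rcases hσ with rfl | rfl <;> simp
  have hle := le_abs_self (σ * (cot (a * k) + 2 * cot (b * k) + α / k))
  rw [abs_mul, hσabs, one_mul] at hle
  have : σ * (α / k) = |α| / k := by rw [← mul_div_assoc, hσα]
  rw [h2, show 2 / |sin (b * k)| = 2 * (1 / |sin (b * k)|) by ring, h4]
  linarith

/-- If `a/b` is badly approximable and `|α| > (4π/√5)·min{2/a, 1/b}`, then the gap
condition GC1 (for the lattice with `b = c`) is satisfied for arbitrarily large `k`. -/
theorem GC1_gaps_badly_approximable_large_coupling (a b α : ℝ) (ha : 0 < a) (hb : 0 < b)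
    (hbad : BadlyApproximable (a / b))
    (hα : |α| > 4 * π / Real.sqrt 5 * min (2 / a) (1 / b)) :
    ∀ K > 0, ∃ k > K, Real.sin (a * k) ≠ 0 ∧ Real.sin (b * k) ≠ 0 ∧
      |Real.cot (a * k) + 2 * Real.cot (b * k) + α / k|
        > 1 / |Real.sin (a * k)| + 2 / |Real.sin (b * k)| := by
  intro K _
  obtain ⟨σ, hσ, hσα⟩ : ∃ σ : ℝ, (σ = 1 ∨ σ = -1) ∧ σ * α = |α| := by
    rcases le_total 0 α with h | h
    · exact ⟨1, Or.inl rfl, by rw [abs_of_nonneg h, one_mul]⟩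
    · exact ⟨-1, Or.inr rfl, by rw [abs_of_nonpos h]; ring⟩
  have h5 : 1.1 * π ^ 2 / 2 < 4 * π / √5 := by
    have h5' : √5 < 2.2361 := by
      rw [Real.sqrt_lt' (by norm_num)]; norm_num
    have h50 : 0 < √5 := by positivity
    have hπ := pi_pos
    have hπ5 : π * √5 < 3.1416 * 2.2361 := by
      have := pi_lt_d4
      gcongr
    rw [lt_div_iff₀ h50]
    nlinarith
  rcases min_choice (2 / a) (1 / b) with hmin | hmin
  · rw [hmin] at hα
    have hA : 1.1 * π ^ 2 / 2 * 2 < |α| * a := by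
      have := mul_lt_mul_of_pos_right hα ha
      rw [show 4 * π / √5 * (2 / a) * a = 4 * π / √5 * 2 by field_simp] at this
      linarith
    obtain ⟨k, hk, n, m, t, s, ht0, htπ, hs0, hsπ, ht, hs, h⟩ :=
      exists_tan_add_tan_lt b a 2 1 |α| σ hb ha two_pos
        (by rw [← inv_div]; exact hbad.1.inv) hσ hA K
    exact ⟨k, hk, gap_condition_of_tan_add_tan_lt a b α σ k s t m n hσ hσα hs0 hsπ ht0 htπ hs ht
      (by linarith)⟩
  · rw [hmin] at hα
    have hA : 1.1 * π ^ 2 / 2 * 1 < |α| * b := by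
      have := mul_lt_mul_of_pos_right hα hb
      rw [show 4 * π / √5 * (1 / b) * b = 4 * π / √5 by field_simp] at this
      linarith
    obtain ⟨k, hk, m, n, s, t, hs0, hsπ, ht0, htπ, hs, ht, h⟩ :=
      exists_tan_add_tan_lt a b 1 2 |α| σ ha hb one_pos hbad.1 hσ hA K
    exact ⟨k, hk, gap_condition_of_tan_add_tan_lt a b α σ k s t m n hσ hσα hs0 hsπ ht0 htπ hs ht
      (by linarith)⟩
end

section
/- Let a, b > 0, α ∈ ℝ, and let k > |α| be such that sin(a·k) ≠ 0 and sin(b·k) ≠ 0. If the gap condition GC2 holds, i.e. 1/|sin(a·k)| − 2/|sin(b·k)| > |cot(a·k) + 2·cot(b·k) + α/k|, then necessarily 1/|sin(a·k)| > 2/|sin(b·k)|, α·cot(a·k) < 0, and cot(a·k)·cot(b·k) < 0. -/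
open Real

lemma inv_abs_sin_sq {θ : ℝ} (h : Real.sin θ ≠ 0) :
    (1 / |Real.sin θ|) ^ 2 = 1 + Real.cot θ ^ 2 := by
  rw [Real.cot_eq_cos_div_sin, div_pow, sq_abs]
  field_simp
  linarith [Real.sin_sq_add_cos_sq θ]

/-- If `u` and `t` are both nonnegative, the two-sided gap inequality fails. -/
lemma gap_le_of_nonneg {x y u v t : ℝ} (hx : 0 < x) (hy : 0 < y)
    (hxu : x ^ 2 = 1 + u ^ 2) (hyv : y ^ 2 = 1 + v ^ 2) (hu : 0 ≤ u)
    (ht : 0 ≤ t) (ht1 : t < 1) : x - 2 * y ≤ |u + 2 * v + t| := by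
  by_contra! h
  obtain ⟨h1, h2⟩ := abs_lt.mp h
  have hx1 : 1 ≤ x := by nlinarith [sq_nonneg u]
  have hpos : 0 < y - v := sub_pos.mpr (lt_of_pow_lt_pow_left₀ 2 hy.le (by linarith))
  have hprod : 0 < ((x - u) - 2 * (y + v)) * ((x + u) * (y - v)) :=
    mul_pos (by linarith) (mul_pos (by linarith) hpos)
  have key : ((x - u) - 2 * (y + v)) * ((x + u) * (y - v)) = (y - v) - 2 * (x + u) := by
    linear_combination (y - v) * hxu - 2 * (x + u) * hyv
  linarith

/-- If `u` and `v` are both nonnegative and `t > -1`, the two-sided gap inequality fails. -/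
lemma gap_le_of_nonneg_of_nonneg {x y u v t : ℝ} (hy : 0 < y)
    (hxu : x ^ 2 = 1 + u ^ 2) (hyv : y ^ 2 = 1 + v ^ 2) (hu : 0 ≤ u)
    (hv : 0 ≤ v) (ht : -1 < t) : x - 2 * y ≤ |u + 2 * v + t| := by
  refine le_trans ?_ (le_abs_self _)
  have hx1 : x ≤ 1 + u := by nlinarith
  have hy1 : 1 ≤ y := by nlinarith [sq_nonneg v]
  linarith

/-- If `k > |α|` and the gap condition GC2 holds, then `1/|sin(a·k)| > 2/|sin(b·k)|`,
`α·cot(a·k) < 0`, and `cot(a·k)·cot(b·k) < 0`. -/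
theorem GC2_necessary_conditions (a b k α : ℝ) (ha : 0 < a) (hb : 0 < b)
    (hk : k > |α|) (hsa : Real.sin (a * k) ≠ 0) (hsb : Real.sin (b * k) ≠ 0)
    (hGC2 : 1 / |Real.sin (a * k)| - 2 / |Real.sin (b * k)|
      > |Real.cot (a * k) + 2 * Real.cot (b * k) + α / k|) :
    1 / |Real.sin (a * k)| > 2 / |Real.sin (b * k)| ∧
    α * Real.cot (a * k) < 0 ∧
    Real.cot (a * k) * Real.cot (b * k) < 0 := by
  have hk0 : 0 < k := (abs_nonneg α).trans_lt hk
  have hx : 0 < 1 / |Real.sin (a * k)| := by positivity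
  have hy : 0 < 1 / |Real.sin (b * k)| := by positivity
  have hxu := inv_abs_sin_sq hsa
  have hyv := inv_abs_sin_sq hsb
  have ht : |α / k| < 1 := by rwa [abs_div, abs_of_pos hk0, div_lt_one hk0]
  obtain ⟨ht1, ht2⟩ := abs_lt.mp ht
  have hα : α = α / k * k := by field_simp
  have h2 : 2 / |Real.sin (b * k)| = 2 * (1 / |Real.sin (b * k)|) := by ring
  refine ⟨by linarith [abs_nonneg (Real.cot (a * k) + 2 * Real.cot (b * k) + α / k)], ?_⟩
  rw [h2] at hGC2
  rw [hα]
  generalize 1 / |Real.sin (a * k)| = x at *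
  generalize 1 / |Real.sin (b * k)| = y at *
  generalize Real.cot (a * k) = u at *
  generalize Real.cot (b * k) = v at *
  generalize α / k = t at *
  have hneg : |-u + 2 * -v + -t| = |u + 2 * v + t| := by
    rw [← abs_neg]; ring_nf
  constructor
  · by_contra! h
    have htu : 0 ≤ t * u := nonneg_of_mul_nonneg_left (by linarith : 0 ≤ t * u * k) hk0
    rcases mul_nonneg_iff.mp htu with ⟨h0, hu⟩ | ⟨h0, hu⟩
    · exact hGC2.not_ge (gap_le_of_nonneg hx hy hxu hyv hu h0 ht2)
    · have := gap_le_of_nonneg (u := -u) (v := -v) (t := -t) hx hy (by rwa [neg_sq])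
        (by rwa [neg_sq]) (by linarith) (by linarith) (by linarith)
      exact hGC2.not_ge (hneg ▸ this)
  · by_contra! h
    rcases mul_nonneg_iff.mp h with ⟨hu, hv⟩ | ⟨hu, hv⟩
    · exact hGC2.not_ge (gap_le_of_nonneg_of_nonneg hy hxu hyv hu hv ht1)
    · have := gap_le_of_nonneg_of_nonneg (u := -u) (v := -v) (t := -t) hy (x := x)
        (by rwa [neg_sq]) (by rwa [neg_sq]) (by linarith) (by linarith) (by linarith)
      exact hGC2.not_ge (hneg ▸ this)
end

section
/- Let a, b > 0 with a/b ∈ ℚ. Then there exists a constant c > 0 such that for all k > 0 with sin(a·k) ≠ 0 and sin(b·k) ≠ 0: if cot(a·k)·cot(b·k) < 0 and |sin(b·k)| ≥ 2·|sin(a·k)|, then G(k) ≥ c, where G(k) = |cot(a·k)| − 2·|cot(b·k)|. -/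
open Real

/-- Every real is an integer multiple of `π` plus a remainder `δ` with `|δ| ≤ π / 2`, on which the
sine and the cotangent are controlled. -/
lemma exists_int_mul_pi_add (x : ℝ) :
    ∃ (n : ℤ) (δ : ℝ), x = n * π + δ ∧ 2 * |δ| ≤ π * |Real.sin x| ∧ 0 ≤ Real.cot x * δ := by
  have hπ := Real.pi_pos
  obtain ⟨n, hn⟩ : ∃ n : ℤ, n = round (x / π) := ⟨_, rfl⟩
  have hδ : |x - n * π| ≤ π / 2 := by
    have h := abs_sub_round (x / π)
    rw [← hn] at h
    have h2 : x - n * π = (x / π - n) * π := by field_simp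
    rw [h2, abs_mul, abs_of_pos hπ]
    nlinarith
  have hs : |Real.sin (x - n * π)| = |Real.sin x| := by
    rw [Real.sin_sub_int_mul_pi, abs_mul, abs_zpow]
    simp
  have hc : Real.cot (x - n * π) = Real.cot x := by
    rw [Real.cot_eq_cos_div_sin, Real.cot_eq_cos_div_sin, Real.sin_sub_int_mul_pi,
      Real.cos_sub_int_mul_pi]
    exact mul_div_mul_left _ _ (zpow_ne_zero _ (by norm_num))
  refine ⟨n, x - n * π, by ring, ?_, ?_⟩
  · have h := Real.mul_abs_le_abs_sin hδ
    rw [hs, div_mul_eq_mul_div, div_le_iff₀ hπ] at h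
    linarith
  · rw [← hc]
    generalize x - n * π = δ at hδ
    obtain ⟨h1, h2⟩ := abs_le.mp hδ
    have hcos : 0 ≤ Real.cos δ := Real.cos_nonneg_of_mem_Icc ⟨by linarith, h2⟩
    rw [Real.cot_eq_cos_div_sin]
    rcases le_total 0 δ with h | h
    · exact mul_nonneg
        (div_nonneg hcos (Real.sin_nonneg_of_nonneg_of_le_pi h (by linarith))) h
    · exact mul_nonneg_of_nonpos_of_nonpos
        (div_nonpos_of_nonneg_of_nonpos hcos
          (Real.sin_nonpos_of_nonpos_of_neg_pi_le h (by linarith))) h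

/-- If `p y = q x` with positive integers `p`, `q` and the cotangents of `x` and `y` have opposite
signs, then the sines of `x` and `y` cannot both be small. -/
lemma two_le_of_cot_mul_cot_neg {p q : ℤ} (hp : 0 < p) (hq : 0 < q) {x y : ℝ}
    (hxy : p * y = q * x) (hcot : Real.cot x * Real.cot y < 0) :
    2 ≤ q * |Real.sin x| + p * |Real.sin y| := by
  have hπ := Real.pi_pos
  have hp' : (0 : ℝ) < p := by exact_mod_cast hp
  have hq' : (0 : ℝ) < q := by exact_mod_cast hq
  obtain ⟨m, η, hx, hη, hcη⟩ := exists_int_mul_pi_add x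
  obtain ⟨n, δ, hy, hδ, hcδ⟩ := exists_int_mul_pi_add y
  by_contra! hlt
  have hdiff : ((p * n - q * m : ℤ) : ℝ) * π = q * η - p * δ := by
    push_cast
    rw [hx, hy] at hxy
    linarith
  have hsmall : |q * η - p * δ| < π := by
    have h := abs_sub (q * η) (p * δ)
    rw [abs_mul, abs_mul, abs_of_pos hp', abs_of_pos hq'] at h
    nlinarith
  have hzero : p * n - q * m = 0 := by
    rw [← hdiff, abs_mul, abs_of_pos hπ] at hsmall
    have h1 : |((p * n - q * m : ℤ) : ℝ)| < 1 := by
      by_contra! h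
      nlinarith
    exact Int.abs_lt_one_iff.mp (by exact_mod_cast h1)
  rw [hzero] at hdiff
  have hprop : q * η = p * δ := by
    push_cast at hdiff
    linarith
  have hδ0 : δ ≠ 0 := by
    rintro rfl
    have hsin : Real.sin y = 0 := by rw [hy, add_zero, Real.sin_int_mul_pi]
    simp [Real.cot_eq_cos_div_sin, hsin] at hcot
  have hpos : 0 < η * δ := by
    have h : 0 < p * (δ * δ) := mul_pos hp' (mul_self_pos.mpr hδ0)
    have h2 : q * (η * δ) = p * (δ * δ) := by linear_combination δ * hprop
    exact pos_of_mul_pos_right (h2 ▸ h) hq'.le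
  nlinarith [mul_nonneg hcη hcδ, mul_pos_of_neg_of_neg hcot (neg_neg_of_pos hpos)]

lemma cot_sq_add_one {x : ℝ} (hx : Real.sin x ≠ 0) :
    |Real.cot x| ^ 2 + 1 = (|Real.sin x| ^ 2)⁻¹ := by
  rw [sq_abs, sq_abs, Real.cot_eq_cos_div_sin]
  field_simp
  linarith [Real.sin_sq_add_cos_sq x]

/-- If `a/b ∈ ℚ`, there is `c > 0` such that whenever `cot(a·k)·cot(b·k) < 0` and
`|sin(b·k)| ≥ 2·|sin(a·k)|`, one has `G(k) = |cot(a·k)| − 2·|cot(b·k)| ≥ c`. -/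
theorem G_lower_bound_rational (a b : ℝ) (ha : 0 < a) (hb : 0 < b)
    (hrat : ∃ r : ℚ, a / b = (r : ℝ)) :
    ∃ c : ℝ, 0 < c ∧ ∀ k : ℝ, 0 < k →
      Real.sin (a * k) ≠ 0 → Real.sin (b * k) ≠ 0 →
      Real.cot (a * k) * Real.cot (b * k) < 0 →
      |Real.sin (b * k)| ≥ 2 * |Real.sin (a * k)| →
      |Real.cot (a * k)| - 2 * |Real.cot (b * k)| ≥ c := by
  obtain ⟨r, hr⟩ := hrat
  have hr0 : 0 < r := by
    have h : (0 : ℝ) < r := hr ▸ div_pos ha hb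
    exact_mod_cast h
  have hp : 0 < r.num := Rat.num_pos.mpr hr0
  have hq : (0 : ℤ) < r.den := by exact_mod_cast r.den_pos
  have hab : (r.num : ℝ) * b = ((r.den : ℤ) : ℝ) * a := by
    have hd : (r.den : ℝ) ≠ 0 := by exact_mod_cast r.den_ne_zero
    rw [Rat.cast_def, div_eq_div_iff hb.ne' hd] at hr
    push_cast
    linarith
  generalize r.num = p at hp hab
  generalize (r.den : ℤ) = q at hq hab
  have hp' : (0 : ℝ) < p := by exact_mod_cast hp
  have hq' : (0 : ℝ) < q := by exact_mod_cast hq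
  refine ⟨1 / (q + 2 * p + 1), by positivity, fun k _ hsa hsb hcot hsin => ?_⟩
  have hlow := two_le_of_cot_mul_cot_neg hp hq (x := a * k) (y := b * k)
    (by linear_combination k * hab) hcot
  have hA := cot_sq_add_one hsa
  have hB := cot_sq_add_one hsb
  have hs : 0 < |Real.sin (a * k)| := abs_pos.mpr hsa
  have ht : 0 < |Real.sin (b * k)| := abs_pos.mpr hsb
  have hu := abs_nonneg (Real.cot (a * k))
  have hv := abs_nonneg (Real.cot (b * k))
  generalize |Real.sin (a * k)| = s at *
  generalize |Real.sin (b * k)| = t at *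
  generalize |Real.cot (a * k)| = u at *
  generalize |Real.cot (b * k)| = v at *
  have hgap : 4 * v ^ 2 + 3 ≤ u ^ 2 := by
    have h : 4 * (t ^ 2)⁻¹ ≤ (s ^ 2)⁻¹ := by
      rw [← div_eq_mul_inv, ← one_div, div_le_div_iff₀ (by positivity) (by positivity)]
      nlinarith
    linarith
  have hvt : 4 * v ≤ q + 2 * p := by
    have hvt1 : v * t ≤ 1 := by
      have h : (v * t) ^ 2 + t ^ 2 = 1 := by
        field_simp at hB
        linarith
      nlinarith [sq_nonneg t]
    have h4 : 4 ≤ (q + 2 * p) * t := by nlinarith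
    by_contra! h
    nlinarith
  by_contra! hlt
  have hD : 0 < (q : ℝ) + 2 * p + 1 := by positivity
  obtain ⟨c, hc⟩ : ∃ c : ℝ, c = 1 / (q + 2 * p + 1) := ⟨_, rfl⟩
  rw [← hc] at hlt
  have hcD : c * (q + 2 * p + 1) = 1 := by
    rw [hc]
    field_simp
  have hc0 : 0 < c := by
    rw [hc]
    positivity
  have hc1 : c ≤ 1 := by nlinarith
  have hsq : u ^ 2 < (2 * v + c) ^ 2 := by
    gcongr
    linarith
  nlinarith [mul_le_mul_of_nonneg_left hvt hc0.le]
end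

section
/- Let a, b > 0 be such that a/b is a badly approximable irrational number. Then there exists a constant c > 0 such that for all k > 0 with sin(a·k) ≠ 0 and sin(b·k) ≠ 0: if cot(a·k)·cot(b·k) < 0 and |sin(b·k)| ≥ 2·|sin(a·k)|, then G(k) > c/k, where G(k) = |cot(a·k)| − 2·|cot(b·k)|. -/
open Real

/-- Every positive real is within `π / 2` of a natural multiple of `π`, and its distance to that
multiple is controlled by its sine. -/
lemma exists_nat_abs_sub_mul_pi_le {t : ℝ} (ht : 0 < t) :
    ∃ n : ℕ, |t - n * π| ≤ π / 2 ∧ |t - n * π| ≤ π / 2 * |Real.sin t| := by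
  have hπ := Real.pi_pos
  obtain ⟨n, hn⟩ : ∃ n : ℕ, |t - n * π| ≤ π / 2 := by
    refine ⟨⌊t / π + 1 / 2⌋₊, ?_⟩
    have h1 := Nat.floor_le (show 0 ≤ t / π + 1 / 2 by positivity)
    have h2 := Nat.lt_floor_add_one (t / π + 1 / 2)
    have h3 : t = t / π * π := by field_simp
    rw [abs_le]
    constructor <;> nlinarith
  refine ⟨n, hn, ?_⟩
  have h1 := Real.mul_abs_le_abs_sin hn
  have h2 : |Real.sin (t - n * π)| = |Real.sin t| := by
    rw [Real.sin_sub_nat_mul_pi, abs_mul, abs_pow, abs_neg, abs_one, one_pow, one_mul]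
  rw [h2] at h1
  calc |t - n * π| = π / 2 * (2 / π * |t - n * π|) := by field_simp
    _ ≤ π / 2 * |Real.sin t| := by gcongr

lemma abs_cot_sub_two_mul_abs_cot_ge {x y : ℝ} (hx : Real.sin x ≠ 0)
    (hxy : 2 * |Real.sin x| ≤ |Real.sin y|) :
    3 / 4 * |Real.sin y| ≤ |Real.cot x| - 2 * |Real.cot y| := by
  rw [Real.cot_eq_cos_div_sin, Real.cot_eq_cos_div_sin, abs_div, abs_div]
  have hs : 0 < |Real.sin x| := abs_pos.mpr hx
  have h1 : |Real.sin x| ^ 2 + |Real.cos x| ^ 2 = 1 := by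
    rw [sq_abs, sq_abs, Real.sin_sq_add_cos_sq]
  have h2 : |Real.sin y| ^ 2 + |Real.cos y| ^ 2 = 1 := by
    rw [sq_abs, sq_abs, Real.sin_sq_add_cos_sq]
  have hC := abs_nonneg (Real.cos x)
  have hD := abs_nonneg (Real.cos y)
  have hC1 := Real.abs_cos_le_one x
  have hD1 := Real.abs_cos_le_one y
  generalize |Real.sin x| = s at *
  generalize |Real.sin y| = S at *
  generalize |Real.cos x| = C at *
  generalize |Real.cos y| = D at *
  have hDC : D ≤ C := by
    refine le_of_sq_le_sq ?_ hC
    nlinarith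
  have h3 : 2 * (D / S) ≤ D / s := by
    rw [← mul_div_assoc, div_le_div_iff₀ (by linarith) hs]
    nlinarith
  have h4 : 3 / 4 * S * s ≤ C - D := by
    have h5 : S ^ 2 - s ^ 2 ≤ 2 * (C - D) := by nlinarith
    nlinarith
  have h6 : 3 / 4 * S ≤ (C - D) / s := by rwa [le_div_iff₀ hs]
  rw [sub_div] at h6
  linarith

/-- For badly approximable `a / b`, the numbers `a * k` and `b * k` are not both close to
multiples of `π`. -/
lemma exists_div_le_abs_sin_of_badlyApproximable {a b : ℝ} (ha : 0 < a) (hb : 0 < b)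
    (hbad : BadlyApproximable (a / b)) :
    ∃ c : ℝ, 0 < c ∧ ∀ k : ℝ, 0 < k → π / 2 < a * k ∨ π / 2 < b * k →
      |Real.sin (a * k)| ≤ |Real.sin (b * k)| → c / k ≤ |Real.sin (b * k)| := by
  obtain ⟨-, γ, hγ, happ⟩ := hbad
  have hπ := Real.pi_pos
  refine ⟨min (π * γ / (a + b)) (min (π * b / (2 * a ^ 2)) (π * a / (2 * b ^ 2))),
    by positivity, fun k hk hlarge hle => ?_⟩
  rw [div_le_iff₀ hk]
  have hak : 0 < a * k := by positivity
  have hbk : 0 < b * k := by positivity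
  obtain ⟨m, hm, hm'⟩ := exists_nat_abs_sub_mul_pi_le hak
  obtain ⟨n, hn, hn'⟩ := exists_nat_abs_sub_mul_pi_le hbk
  rcases Nat.eq_zero_or_pos n with rfl | hn0
  · simp only [Nat.cast_zero, zero_mul, sub_zero, abs_of_pos hbk] at hn hn'
    have hak' : π / 2 < a * k := hlarge.resolve_right hn.not_gt
    refine (min_le_right _ _).trans ((min_le_left _ _).trans ?_)
    rw [div_le_iff₀ (by positivity)]
    have h1 : (π / 2) ^ 2 ≤ (a * k) ^ 2 := by gcongr
    have h2 : (π / 2) ^ 2 * b ≤ a ^ 2 * k * (π / 2 * |Real.sin (b * k)|) :=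
      calc (π / 2) ^ 2 * b ≤ (a * k) ^ 2 * b := by gcongr
        _ = a ^ 2 * k * (b * k) := by ring
        _ ≤ _ := by gcongr
    refine le_of_mul_le_mul_left ?_ (show 0 < π / 4 by positivity)
    linarith
  rcases Nat.eq_zero_or_pos m with rfl | hm0
  · simp only [Nat.cast_zero, zero_mul, sub_zero, abs_of_pos hak] at hm hm'
    have hbk' : π / 2 < b * k := hlarge.resolve_left hm.not_gt
    refine (min_le_right _ _).trans ((min_le_right _ _).trans ?_)
    rw [div_le_iff₀ (by positivity)]
    have h2 : (π / 2) ^ 2 * a ≤ b ^ 2 * k * (π / 2 * |Real.sin (b * k)|) :=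
      calc (π / 2) ^ 2 * a ≤ (b * k) ^ 2 * a := by gcongr
        _ = b ^ 2 * k * (a * k) := by ring
        _ ≤ b ^ 2 * k * (π / 2 * |Real.sin (a * k)|) := by gcongr
        _ ≤ _ := by gcongr
    refine le_of_mul_le_mul_left ?_ (show 0 < π / 4 by positivity)
    linarith
  refine (min_le_left _ _).trans ?_
  have hnR : (1 : ℝ) ≤ n := by exact_mod_cast hn0
  have hnk : n * π ≤ 2 * (b * k) := by
    have := (abs_le.mp hn).1
    nlinarith
  have h1 : π * b * n * |a / b - m / n| ≤ (a + b) * (π / 2 * |Real.sin (b * k)|) :=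
    calc π * b * n * |a / b - m / n| = |π * b * n * (a / b - m / n)| := by
          rw [abs_mul, abs_of_pos (show 0 < π * b * n by positivity)]
      _ = |b * (a * k - m * π) - a * (b * k - n * π)| := by
          congr 1
          field_simp
          ring
      _ ≤ b * |a * k - m * π| + a * |b * k - n * π| := by
          refine (abs_sub _ _).trans_eq ?_
          rw [abs_mul, abs_mul, abs_of_pos ha, abs_of_pos hb]
      _ ≤ b * (π / 2 * |Real.sin (b * k)|) + a * (π / 2 * |Real.sin (b * k)|) := by
          have := hm'.trans (mul_le_mul_of_nonneg_left hle (by positivity))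
          gcongr
      _ = _ := by ring
  have h2 : π * b * γ ≤ π * b * n * |a / b - m / n| * n := by
    have h := (happ m n hm0 hn0).le
    rw [div_le_iff₀ (by positivity)] at h
    calc π * b * γ ≤ π * b * (|a / b - m / n| * n ^ 2) := by gcongr
      _ = _ := by ring
  have h3 : π * b * γ * π ≤ (a + b) * (π / 2 * |Real.sin (b * k)|) * (2 * (b * k)) :=
    calc π * b * γ * π ≤ (π * b * n * |a / b - m / n| * n) * π := by gcongr
      _ ≤ ((a + b) * (π / 2 * |Real.sin (b * k)|) * n) * π := by gcongr
      _ = (a + b) * (π / 2 * |Real.sin (b * k)|) * (n * π) := by ring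
      _ ≤ _ := by gcongr
  rw [div_le_iff₀ (by positivity)]
  refine le_of_mul_le_mul_left ?_ (show 0 < π * b by positivity)
  linarith

lemma cot_nonneg_of_nonneg_of_le_pi_div_two {x : ℝ} (h0 : 0 ≤ x) (h1 : x ≤ π / 2) :
    0 ≤ Real.cot x := by
  rw [Real.cot_eq_cos_div_sin]
  exact div_nonneg (Real.cos_nonneg_of_mem_Icc ⟨by linarith, h1⟩)
    (Real.sin_nonneg_of_nonneg_of_le_pi h0 (by linarith))

/-- If `a/b` is a badly approximable irrational, there is `c > 0` such that whenever
`cot(a·k)·cot(b·k) < 0` and `|sin(b·k)| ≥ 2·|sin(a·k)|`, one has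
`G(k) = |cot(a·k)| − 2·|cot(b·k)| > c/k`. -/
theorem G_lower_bound_badly_approximable (a b : ℝ) (ha : 0 < a) (hb : 0 < b)
    (hbad : BadlyApproximable (a / b)) :
    ∃ c : ℝ, 0 < c ∧ ∀ k : ℝ, 0 < k →
      Real.sin (a * k) ≠ 0 → Real.sin (b * k) ≠ 0 →
      Real.cot (a * k) * Real.cot (b * k) < 0 →
      |Real.sin (b * k)| ≥ 2 * |Real.sin (a * k)| →
      |Real.cot (a * k)| - 2 * |Real.cot (b * k)| > c / k := by
  obtain ⟨c, hc, h⟩ := exists_div_le_abs_sin_of_badlyApproximable ha hb hbad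
  refine ⟨c / 2, by positivity, fun k hk hsa hsb hcot hsin => ?_⟩
  have hlarge : π / 2 < a * k ∨ π / 2 < b * k := by
    by_contra! hsmall
    exact hcot.not_ge (mul_nonneg
      (cot_nonneg_of_nonneg_of_le_pi_div_two (by positivity) hsmall.1)
      (cot_nonneg_of_nonneg_of_le_pi_div_two (by positivity) hsmall.2))
  have h1 := h k hk hlarge (by linarith [abs_nonneg (Real.sin (a * k))])
  have h2 := abs_cot_sub_two_mul_abs_cot_ge hsa hsin
  have h3 : 0 < c / k := by positivity
  have h4 : c / 2 / k = c / k / 2 := by ring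
  rw [h4]
  linarith
end

section
/- Let a, b > 0 be such that a/b is a badly approximable irrational number. Then there exists α₀ > 0 such that for every α ∈ ℝ with |α| ≤ α₀ and every k > |α| with sin(a·k) ≠ 0 and sin(b·k) ≠ 0, the gap condition GC2 fails, i.e. 1/|sin(a·k)| − 2/|sin(b·k)| ≤ |cot(a·k) + 2·cot(b·k) + α/k|. (Hence for |α| ≤ α₀ the condition GC2 generates no gaps in the spectrum of the honeycomb-lattice Hamiltonian with edge lengths a, b, b.) -/
open Real

/-- If `p² = 1 + C²` and `q² = 1 + V²` with `p, q ≥ 1`, and `p - 2q > |C + 2V + β|` with `|β| < 1`,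
then `C` and `V` have opposite signs and both `p` and `q` are at least `1 / (2|β|)`. -/
lemma bounds_of_gap {p q C V β : ℝ} (hp : 1 ≤ p) (hq : 1 ≤ q) (hpC : p ^ 2 = 1 + C ^ 2)
    (hqV : q ^ 2 = 1 + V ^ 2) (hβ : |β| < 1) (h : |C + 2 * V + β| < p - 2 * q) :
    C * V < 0 ∧ 1 ≤ 2 * |β| * p ∧ 1 ≤ 2 * |β| * q := by
  have hB := abs_nonneg β
  have hCV : |C + 2 * V| - |β| < p - 2 * q := by
    have := abs_sub_abs_le_abs_sub (C + 2 * V) (-β)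
    rw [abs_neg, sub_neg_eq_add] at this
    linarith
  rw [← sq_abs C] at hpC
  rw [← sq_abs V] at hqV
  have hC := abs_nonneg C
  have hV := abs_nonneg V
  have hneg : C * V < 0 := by
    by_contra! hn
    have habs : |C + 2 * V| = |C| + 2 * |V| := by
      rcases mul_nonneg_iff.1 hn with ⟨h1, h2⟩ | ⟨h1, h2⟩
      · rw [abs_of_nonneg h1, abs_of_nonneg h2, abs_of_nonneg (by linarith)]
      · rw [abs_of_nonpos h1, abs_of_nonpos h2, abs_of_nonpos (by linarith)]
        ring
    have : p ≤ 1 + |C| := by nlinarith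
    linarith
  have h12 : |C| - 2 * |V| - |β| < p - 2 * q ∧ 2 * |V| - |C| - |β| < p - 2 * q := by
    have h1 := abs_sub_abs_le_abs_sub C (-(2 * V))
    have h2 := abs_sub_abs_le_abs_sub (2 * V) (-C)
    simp only [abs_neg, sub_neg_eq_add, abs_mul, abs_two] at h1 h2
    rw [add_comm (2 * V) C] at h2
    constructor <;> linarith
  refine ⟨hneg, ?_⟩
  obtain ⟨P, hP⟩ : ∃ P, P = p + |C| := ⟨_, rfl⟩
  obtain ⟨T, hT⟩ : ∃ T, T = p - |C| := ⟨_, rfl⟩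
  obtain ⟨Q, hQ⟩ : ∃ Q, Q = q + |V| := ⟨_, rfl⟩
  obtain ⟨E, hE⟩ : ∃ E, E = q - |V| := ⟨_, rfl⟩
  have hPT : P * T = 1 := by rw [hP, hT]; linarith
  have hQE : Q * E = 1 := by rw [hQ, hE]; linarith
  have hP1 : 1 ≤ P := by linarith
  have hQ1 : 1 ≤ Q := by linarith
  have hTpos : 0 < T := pos_of_mul_pos_right (by rw [hPT]; exact one_pos) (by linarith)
  have hEpos : 0 < E := pos_of_mul_pos_right (by rw [hQE]; exact one_pos) (by linarith)
  have hET : 2 * E < T + |β| := by linarith [h12.1, h12.2]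
  have hQP : 2 * Q < P + |β| := by linarith [h12.1, h12.2]
  have h4 : (2 * Q) * (2 * E) < (P + |β|) * (T + |β|) :=
    mul_lt_mul'' hQP hET (by linarith) (by linarith)
  have hTP : T ≤ P := by linarith
  have hBP : 1 < |β| * P := by nlinarith
  have hTB : T < |β| := by nlinarith
  have hEB : E < |β| := by linarith
  have hBQ : 1 ≤ |β| * Q := by nlinarith
  constructor
  · nlinarith
  · nlinarith

/-- If the gap inequality holds with `|β| < 1`, then the two cotangents have opposite signs and
both sines are at most `2|β|` in absolute value. -/
lemma abs_sin_le_of_gap {x y β : ℝ} (hx : sin x ≠ 0) (hy : sin y ≠ 0) (hβ : |β| < 1)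
    (h : |cot x + 2 * cot y + β| < 1 / |sin x| - 2 / |sin y|) :
    cot x * cot y < 0 ∧ |sin x| ≤ 2 * |β| ∧ |sin y| ≤ 2 * |β| := by
  have key : ∀ z : ℝ, sin z ≠ 0 →
      1 ≤ 1 / |sin z| ∧ (1 / |sin z|) ^ 2 = 1 + cot z ^ 2 := by
    intro z hz
    refine ⟨(one_le_div (abs_pos.2 hz)).2 (abs_sin_le_one z), ?_⟩
    rw [cot_eq_cos_div_sin, div_pow, div_pow, sq_abs]
    have := sin_sq_add_cos_sq z
    field_simp
    linarith
  obtain ⟨hp, hpC⟩ := key x hx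
  obtain ⟨hq, hqV⟩ := key y hy
  obtain ⟨h1, h2, h3⟩ := bounds_of_gap hp hq hpC hqV hβ (by convert h using 1; ring)
  refine ⟨h1, ?_, ?_⟩
  · rwa [mul_one_div, one_le_div (abs_pos.2 hx)] at h2
  · rwa [mul_one_div, one_le_div (abs_pos.2 hy)] at h3

/-- A positive real whose sine is at most `2B` in absolute value is within `πB` of its nearest
multiple of `π`. -/
lemma exists_nat_abs_sub_mul_pi_le_s16 {x B : ℝ} (hx : 0 < x) (h : |sin x| ≤ 2 * B) :
    ∃ m : ℕ, |x - m * π| ≤ π / 2 ∧ |x - m * π| ≤ π * B := by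
  have hpi := pi_pos
  have hround : |x - round (x / π) * π| ≤ π / 2 := by
    have h1 := abs_sub_round (x / π)
    have h2 : x - round (x / π) * π = (x / π - round (x / π)) * π := by field_simp
    rw [h2, abs_mul, abs_of_pos hpi]
    nlinarith
  have hm : 0 ≤ round (x / π) := by
    have h1 := (abs_le.1 hround).2
    by_contra! hneg
    have h2 : (round (x / π) : ℝ) ≤ -1 := by exact_mod_cast Int.le_sub_one_of_lt hneg
    nlinarith
  obtain ⟨m, hm⟩ := Int.eq_ofNat_of_zero_le hm
  rw [hm, Int.cast_natCast] at hround
  refine ⟨m, hround, ?_⟩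
  have h1 := mul_abs_le_abs_sin hround
  have h2 : |sin (x - m * π)| = |sin x| := by
    rw [sin_sub_nat_mul_pi, abs_mul, abs_pow, abs_neg, abs_one, one_pow, one_mul]
  rw [h2] at h1
  have h3 : 2 / π * |x - m * π| ≤ 2 * B := h1.trans h
  rw [div_mul_eq_mul_div, div_le_iff₀ hpi] at h3
  linarith

/-- If `a * k` and `b * k` lie within `πB` of `mπ` and `nπ`, then `m / n` approximates `a / b`. -/
lemma abs_div_sub_div_le {a b k B : ℝ} {m n : ℕ} (ha : 0 < a) (hb : 0 < b) (hn : 0 < n)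
    (h1 : |a * k - m * π| ≤ π * B) (h2 : |b * k - n * π| ≤ π * B) :
    |a / b - (m : ℝ) / n| ≤ (a + b) * B / (b * n) := by
  have hn' : (0 : ℝ) < n := by exact_mod_cast hn
  have hpi := pi_pos
  rw [div_sub_div _ _ hb.ne' hn'.ne', abs_div, abs_of_pos (mul_pos hb hn')]
  gcongr
  rw [abs_le] at *
  constructor <;> nlinarith

/-- If `a/b` is badly approximable, there is `α₀ > 0` such that for `|α| ≤ α₀` the gap
condition GC2 fails for every admissible `k > |α|`: GC2 generates no gaps. -/
theorem GC2_no_gaps_badly_approximable (a b : ℝ) (ha : 0 < a) (hb : 0 < b)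
    (hbad : BadlyApproximable (a / b)) :
    ∃ α₀ : ℝ, 0 < α₀ ∧ ∀ α : ℝ, |α| ≤ α₀ → ∀ k : ℝ, k > |α| →
      Real.sin (a * k) ≠ 0 → Real.sin (b * k) ≠ 0 →
      1 / |Real.sin (a * k)| - 2 / |Real.sin (b * k)|
        ≤ |Real.cot (a * k) + 2 * Real.cot (b * k) + α / k| := by
  obtain ⟨-, γ, hγ, happrox⟩ := hbad
  have hpi := pi_pos
  have hab : 0 < a + b := by linarith
  refine ⟨min (γ / (a + b)) (min a b * π / (8 * (a + b) ^ 2)), by positivity, ?_⟩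
  intro α hα k hk hsa hsb
  obtain ⟨hα1, hα2⟩ := le_min_iff.1 hα
  rw [le_div_iff₀ hab] at hα1
  rw [le_div_iff₀ (by positivity)] at hα2
  have hk0 : 0 < k := (abs_nonneg α).trans_lt hk
  have hβ : |α / k| = |α| / k := by rw [abs_div, abs_of_pos hk0]
  by_contra! hgap
  obtain ⟨hsign, hx, hy⟩ := abs_sin_le_of_gap hsa hsb
    (by rwa [hβ, div_lt_one hk0]) hgap
  have hklarge : π / 2 ≤ (a + b) * k := by
    by_contra! hsmall
    have hpos : ∀ z : ℝ, 0 < z → z < π / 2 → 0 < cot z := fun z h0 h1 ↦ by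
      rw [cot_eq_cos_div_sin]
      exact div_pos (cos_pos_of_mem_Ioo ⟨by linarith, h1⟩)
        (sin_pos_of_pos_of_lt_pi h0 (by linarith))
    have hak := mul_pos ha hk0
    have hbk := mul_pos hb hk0
    exact hsign.not_gt (mul_pos (hpos _ hak (by linarith)) (hpos _ hbk (by linarith)))
  rw [hβ] at hx hy
  have hne : ∀ c : ℝ, min a b ≤ c → 0 < c → ¬ |c * k - (0 : ℕ) * π| ≤ π * (|α| / k) := by
    intro c hc hc0 hle
    rw [Nat.cast_zero, zero_mul, sub_zero, abs_of_pos (mul_pos hc0 hk0), mul_div_assoc',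
      le_div_iff₀ hk0] at hle
    have h1 : (π / 2) ^ 2 ≤ ((a + b) * k) ^ 2 := by gcongr
    have h2 : c * (π / 2) ^ 2 ≤ c * ((a + b) * k) ^ 2 := by gcongr
    have h3 : c * k * k * (a + b) ^ 2 ≤ π * |α| * (a + b) ^ 2 := by gcongr
    have h4 : min a b * π * π ≤ c * π * π := by gcongr
    have h5 : π * (|α| * (8 * (a + b) ^ 2)) ≤ π * (min a b * π) := by gcongr
    have h6 : 0 < c * π * π := by positivity
    nlinarith
  obtain ⟨m, -, hm⟩ := exists_nat_abs_sub_mul_pi_le_s16 (mul_pos ha hk0) hx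
  obtain ⟨n, hn', hn⟩ := exists_nat_abs_sub_mul_pi_le_s16 (mul_pos hb hk0) hy
  have hm0 : 0 < m := by
    rcases Nat.eq_zero_or_pos m with rfl | h
    · exact absurd hm (hne a (min_le_left _ _) ha)
    · exact h
  have hn0 : 0 < n := by
    rcases Nat.eq_zero_or_pos n with rfl | h
    · exact absurd hn (hne b (min_le_right _ _) hb)
    · exact h
  refine (happrox m n hm0 hn0).not_ge ((abs_div_sub_div_le ha hb hn0 hm hn).trans ?_)
  have hn1 : (1 : ℝ) ≤ n := by exact_mod_cast hn0
  have hnk : (n : ℝ) ≤ b * k := by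
    have := (abs_le.1 hn').1
    nlinarith [pi_gt_three]
  rw [mul_div_assoc', div_div, div_le_div_iff₀ (by positivity) (by positivity)]
  calc (a + b) * |α| * (n : ℝ) ^ 2 ≤ γ * (n * (b * k)) := by
        rw [sq, mul_comm (a + b)]
        gcongr
    _ = γ * (k * (b * n)) := by ring
end

section
/- Let a, b, c > 0, k > 0 with sin(a·k) ≠ 0, α ∈ ℝ, and θ₁, θ₂ ∈ ℝ. For j ∈ {1, 2} set σ_j = (−1)^{j−1}, m_{3j} = (−exp(−i·σ_j·a·k) + exp(i·(σ_j·b·k − θ₁)))/sin(a·k) − α/k, and m_{4j} = (−exp(i·(σ_j·a·k + σ_j·b·k − θ₁)) + 1)/sin(a·k) − (α/k)·exp(i·(σ_j·b·k − θ₁)). Let M be the 4×4 complex matrix with rows (1, 1, −1, −1); (exp(i(b·k − θ₁)), exp(i(−b·k − θ₁)), −exp(i(c·k − θ₂)), −exp(i(−c·k − θ₂))); (m_{31}, m_{32}, i, −i); (m_{41}, m_{42}, −i·exp(i(c·k − θ₂)), i·exp(i(−c·k − θ₂))). Then det(M) = −4·[2·sin(a·k)·cos(b·k)·cos(c·k)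 + 2·cos(a·k)·sin(b·k)·cos(c·k) + 2·cos(a·k)·cos(b·k)·sin(c·k) − 3·sin(a·k)·sin(b·k)·sin(c·k) − 2·sin(a·k)·cos(θ₁ − θ₂) − 2·sin(c·k)·cos(θ₁) − 2·sin(b·k)·cos(θ₂) + 2·(α/k)·(cos(a·k)·sin(b·k)·sin(c·k) + sin(a·k)·cos(b·k)·sin(c·k) + sin(a·k)·sin(b·k)·cos(c·k)) + (α²/k²)·sin(a·k)·sin(b·k)·sin(c·k)]·exp(−i(θ₁ + θ₂))/sin(a·k). -/
open Real Complex

/-- Matrix entry `m_{3j}` (with `σ = σ_j = (−1)^{j−1}`). -/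
noncomputable def mRow3 (a b k α θ₁ σ : ℝ) : ℂ :=
  (-Complex.exp (-Complex.I * ((σ * a * k : ℝ) : ℂ))
      + Complex.exp (Complex.I * ((σ * b * k - θ₁ : ℝ) : ℂ))) / ((Real.sin (a * k) : ℝ) : ℂ)
    - ((α / k : ℝ) : ℂ)

/-- Matrix entry `m_{4j}` (with `σ = σ_j = (−1)^{j−1}`). -/
noncomputable def mRow4 (a b k α θ₁ σ : ℝ) : ℂ :=
  (-Complex.exp (Complex.I * ((σ * a * k + σ * b * k - θ₁ : ℝ) : ℂ)) + 1)
      / ((Real.sin (a * k) : ℝ) : ℂ)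
    - ((α / k : ℝ) : ℂ) * Complex.exp (Complex.I * ((σ * b * k - θ₁ : ℝ) : ℂ))

/-- The coefficient matrix `M` of the Floquet–Bloch linear system on the elementary cell
of the dilated honeycomb lattice. -/
noncomputable def Mmat (a b c k α θ₁ θ₂ : ℝ) : Matrix (Fin 4) (Fin 4) ℂ :=
  !![1, 1, -1, -1;
     Complex.exp (Complex.I * ((b * k - θ₁ : ℝ) : ℂ)),
       Complex.exp (Complex.I * ((-(b * k) - θ₁ : ℝ) : ℂ)),
       -Complex.exp (Complex.I * ((c * k - θ₂ : ℝ) : ℂ)),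
       -Complex.exp (Complex.I * ((-(c * k) - θ₂ : ℝ) : ℂ));
     mRow3 a b k α θ₁ 1, mRow3 a b k α θ₁ (-1), Complex.I, -Complex.I;
     mRow4 a b k α θ₁ 1, mRow4 a b k α θ₁ (-1),
       -Complex.I * Complex.exp (Complex.I * ((c * k - θ₂ : ℝ) : ℂ)),
       Complex.I * Complex.exp (Complex.I * ((-(c * k) - θ₂ : ℝ) : ℂ))]

/-- Euler's formula for a shifted phase, written so that `θ` enters only through `exp (-I * θ)`. -/
lemma exp_I_mul_sub (x θ : ℝ) :
    Complex.exp (Complex.I * ((x - θ : ℝ) : ℂ)) =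
      (((Real.cos x : ℝ) : ℂ) + Complex.I * ((Real.sin x : ℝ) : ℂ)) *
        Complex.exp (-Complex.I * (θ : ℂ)) := by
  have h : Complex.I * ((x - θ : ℝ) : ℂ) = (x : ℂ) * Complex.I + -Complex.I * (θ : ℂ) := by
    push_cast; ring
  rw [h, Complex.exp_add, Complex.exp_mul_I, Complex.ofReal_cos, Complex.ofReal_sin]
  ring

lemma mRow3_eq (a b k α θ₁ σ : ℝ) :
    mRow3 a b k α θ₁ σ =
      (-(((Real.cos (σ * a * k) : ℝ) : ℂ) - I * ((Real.sin (σ * a * k) : ℝ) : ℂ))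
        + (((Real.cos (σ * b * k) : ℝ) : ℂ) + I * ((Real.sin (σ * b * k) : ℝ) : ℂ))
          * Complex.exp (-I * (θ₁ : ℂ))) * ((Real.sin (a * k) : ℝ) : ℂ)⁻¹
        - ((α / k : ℝ) : ℂ) := by
  have h : Complex.exp (-I * ((σ * a * k : ℝ) : ℂ)) =
      ((Real.cos (σ * a * k) : ℝ) : ℂ) - I * ((Real.sin (σ * a * k) : ℝ) : ℂ) := by
    rw [neg_mul, mul_comm, ← neg_mul, Complex.exp_mul_I, Complex.cos_neg, Complex.sin_neg,
      Complex.ofReal_cos, Complex.ofReal_sin]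
    ring
  rw [mRow3, exp_I_mul_sub, h, div_eq_mul_inv]

lemma mRow4_eq (a b k α θ₁ σ : ℝ) :
    mRow4 a b k α θ₁ σ =
      (-((((Real.cos (σ * a * k) : ℝ) : ℂ) + I * ((Real.sin (σ * a * k) : ℝ) : ℂ))
          * (((Real.cos (σ * b * k) : ℝ) : ℂ) + I * ((Real.sin (σ * b * k) : ℝ) : ℂ))
          * Complex.exp (-I * (θ₁ : ℂ))) + 1) * ((Real.sin (a * k) : ℝ) : ℂ)⁻¹
        - ((α / k : ℝ) : ℂ)
          * ((((Real.cos (σ * b * k) : ℝ) : ℂ) + I * ((Real.sin (σ * b * k) : ℝ) : ℂ))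
            * Complex.exp (-I * (θ₁ : ℂ))) := by
  rw [mRow4, exp_I_mul_sub, exp_I_mul_sub, div_eq_mul_inv, Real.cos_add, Real.sin_add]
  push_cast
  linear_combination (Complex.sin (σ * a * k) * Complex.sin (σ * b * k)
    * Complex.exp (-I * θ₁) * (Complex.sin (a * k))⁻¹) * I_sq

/-- The secular determinant as a polynomial identity in sines and cosines, the inverse `u` of `sa`,
and two invertible phases. -/
lemma det_secular_matrix (sa ca sb cb sc cc u p pinv q qinv t : ℂ)
    (hu : sa * u = 1) (ha : ca ^ 2 + sa ^ 2 = 1) (hb : cb ^ 2 + sb ^ 2 = 1)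
    (hc : cc ^ 2 + sc ^ 2 = 1) (hp : p * pinv = 1) (hq : q * qinv = 1) :
    (!![1, 1, -1, -1;
        (cb + I * sb) * p, (cb - I * sb) * p, -((cc + I * sc) * q), -((cc - I * sc) * q);
        (-(ca - I * sa) + (cb + I * sb) * p) * u - t,
          (-(ca + I * sa) + (cb - I * sb) * p) * u - t, I, -I;
        (-((ca + I * sa) * (cb + I * sb) * p) + 1) * u - t * ((cb + I * sb) * p),
          (-((ca - I * sa) * (cb - I * sb) * p) + 1) * u - t * ((cb - I * sb) * p),
          -I * ((cc + I * sc) * q), I * ((cc - I * sc) * q)] : Matrix (Fin 4) (Fin 4) ℂ).det =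
      -4 * (2 * sa * cb * cc + 2 * ca * sb * cc + 2 * ca * cb * sc - 3 * sa * sb * sc
        - sa * (p * qinv + pinv * q) - sc * (p + pinv) - sb * (q + qinv)
        + 2 * t * (ca * sb * sc + sa * cb * sc + sa * sb * cc) + t ^ 2 * sa * sb * sc)
        * (p * q) * u := by
  have hI : I ^ 2 = -1 := I_sq
  simp [Matrix.det_succ_row_zero, Fin.sum_univ_succ, Fin.succAbove]
  grind

/-- Explicit evaluation of `det M` for the Floquet–Bloch spectral condition of the
dilated honeycomb lattice with `δ`-coupling of strength `α`. -/
theorem det_M_eval (a b c k α θ₁ θ₂ : ℝ) (ha : 0 < a) (hb : 0 < b) (hc : 0 < c)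
    (hk : 0 < k) (hsa : Real.sin (a * k) ≠ 0) :
    (Mmat a b c k α θ₁ θ₂).det =
      (-4 : ℂ) *
        (((2 * Real.sin (a * k) * Real.cos (b * k) * Real.cos (c * k)
          + 2 * Real.cos (a * k) * Real.sin (b * k) * Real.cos (c * k)
          + 2 * Real.cos (a * k) * Real.cos (b * k) * Real.sin (c * k)
          - 3 * Real.sin (a * k) * Real.sin (b * k) * Real.sin (c * k)
          - 2 * Real.sin (a * k) * Real.cos (θ₁ - θ₂)
          - 2 * Real.sin (c * k) * Real.cos θ₁
          - 2 * Real.sin (b * k) * Real.cos θ₂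
          + 2 * (α / k) * (Real.cos (a * k) * Real.sin (b * k) * Real.sin (c * k)
            + Real.sin (a * k) * Real.cos (b * k) * Real.sin (c * k)
            + Real.sin (a * k) * Real.sin (b * k) * Real.cos (c * k))
          + (α ^ 2 / k ^ 2) * Real.sin (a * k) * Real.sin (b * k) * Real.sin (c * k) : ℝ)) : ℂ)
        * Complex.exp (-Complex.I * ((θ₁ + θ₂ : ℝ) : ℂ)) / ((Real.sin (a * k) : ℝ) : ℂ) := by
  have hp : ∀ θ : ℝ, Complex.exp (-I * (θ : ℂ)) * Complex.exp (I * (θ : ℂ)) = 1 := by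
    intro θ
    rw [← Complex.exp_add]; simp
  have hcos : ∀ θ : ℝ, 2 * ((Real.cos θ : ℝ) : ℂ) =
      Complex.exp (-I * (θ : ℂ)) + Complex.exp (I * (θ : ℂ)) := by
    intro θ
    rw [Complex.ofReal_cos, Complex.two_cos, add_comm]
    congr 2 <;> ring
  have hcs : ∀ x : ℝ, ((Real.cos x : ℝ) : ℂ) ^ 2 + ((Real.sin x : ℝ) : ℂ) ^ 2 = 1 := by
    intro x
    exact_mod_cast Real.cos_sq_add_sin_sq x
  have hu : ((Real.sin (a * k) : ℝ) : ℂ) * ((Real.sin (a * k) : ℝ) : ℂ)⁻¹ = 1 :=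
    mul_inv_cancel₀ (by exact_mod_cast hsa)
  have hdet := det_secular_matrix (Real.sin (a * k) : ℝ) (Real.cos (a * k) : ℝ)
    (Real.sin (b * k) : ℝ) (Real.cos (b * k) : ℝ) (Real.sin (c * k) : ℝ) (Real.cos (c * k) : ℝ)
    _ _ _ _ _ ((α / k : ℝ) : ℂ) hu (hcs _) (hcs _) (hcs _) (hp θ₁) (hp θ₂)
  have hdiff : 2 * ((Real.cos (θ₁ - θ₂) : ℝ) : ℂ) =
      Complex.exp (-I * (θ₁ : ℂ)) * Complex.exp (I * (θ₂ : ℂ)) +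
        Complex.exp (I * (θ₁ : ℂ)) * Complex.exp (-I * (θ₂ : ℂ)) := by
    rw [hcos, ← Complex.exp_add, ← Complex.exp_add]
    push_cast
    ring_nf
  have hsum : Complex.exp (-I * ((θ₁ + θ₂ : ℝ) : ℂ)) =
      Complex.exp (-I * (θ₁ : ℂ)) * Complex.exp (-I * (θ₂ : ℂ)) := by
    rw [← Complex.exp_add]
    push_cast
    ring_nf
  refine Eq.trans ?_ (hdet.trans ?_)
  · rw [Mmat, mRow3_eq, mRow3_eq, mRow4_eq, mRow4_eq]
    simp only [exp_I_mul_sub, neg_mul, mul_neg, one_mul, Real.cos_neg, Real.sin_neg,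
      Complex.ofReal_neg, ← sub_eq_add_neg, sub_neg_eq_add]
  · rw [← hcos, ← hcos, ← hdiff, hsum, div_eq_mul_inv]
    push_cast
    ring
end
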